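/- arXiv:1211.6287 — 3 statements merged into one kernel-verified Lean document; each statement's English description precedes it below -/
import Mathlib

section
/- Suppose that for $i = 1, 2$, $G_i$ is a graph with $m_i$ edges and with no isolated vertices. If $m = \max\{m_1, m_2\}$, then $R(G_1, G_2) \leq 2^{250\sqrt{m}}$. -/
/-- `G` occurs as a (not necessarily induced) subgraph copy of `H`. -/
def IsCopyIn {α β : Type*} (G : SimpleGraph α) (H : SimpleGraph β) : Prop :=
  ∃ f : α ↪ β, ∀ ⦃a b : α⦄, G.Adj a b → H.Adj (f a) (f b)

/-- `N` has the Ramsey property for the pair `(G₁, G₂)`: every blue-red edge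
coloring of `K_N` (encoded by its graph of blue edges) contains a blue copy of `G₁`
or a red copy of `G₂`. -/
def RamseyProp {α β : Type*} (G₁ : SimpleGraph α) (G₂ : SimpleGraph β) (N : ℕ) : Prop :=
  ∀ blue : SimpleGraph (Fin N), IsCopyIn G₁ blue ∨ IsCopyIn G₂ blueᶜ

/-- The Ramsey number `R(G₁, G₂)`: the smallest positive integer `N` with the
Ramsey property. -/
noncomputable def ramsey {α β : Type*} (G₁ : SimpleGraph α) (G₂ : SimpleGraph β) : ℕ :=
  sInf {N : ℕ | 0 < N ∧ RamseyProp G₁ G₂ N}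

open Classical in
/-- `(X, Y)` is a monochromatic pair in colour `F`. -/
def PairIn {V : Type*} (F : SimpleGraph V) (X Z : Finset V) : Prop :=
  Disjoint X Z ∧ (∀ x ∈ X, ∀ y ∈ X, x ≠ y → F.Adj x y) ∧ (∀ x ∈ X, ∀ y ∈ Z, F.Adj x y)

/-- Existence of a monochromatic pair of given sizes inside `Y`. -/
def HasPair {V : Type*} (F : SimpleGraph V) (Y : Finset V) (x M : ℕ) : Prop :=
  ∃ X Z : Finset V, X ⊆ Y ∧ Z ⊆ Y ∧ PairIn F X Z ∧ X.card = x ∧ M ≤ Z.card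

/-- The part `S` of `G` embeds into `F` restricted to `Y`. -/
def EmbIn {α V : Type*} (G : SimpleGraph α) (S : Finset α) (F : SimpleGraph V)
    (Y : Finset V) : Prop :=
  ∃ f : α → V, Set.InjOn f S ∧ (∀ a ∈ S, f a ∈ Y) ∧
    ∀ a ∈ S, ∀ b ∈ S, G.Adj a b → F.Adj (f a) (f b)

theorem EmbIn.mono {α V : Type*} {G : SimpleGraph α} {S : Finset α} {F : SimpleGraph V}
    {Y Y' : Finset V} (hY : Y ⊆ Y') (h : EmbIn G S F Y) : EmbIn G S F Y' := by
  obtain ⟨f, h1, h2, h3⟩ := h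
  exact ⟨f, h1, fun a ha => hY (h2 a ha), h3⟩

theorem HasPair.mono {V : Type*} {F : SimpleGraph V} {Y Y' : Finset V} {x x' M M' : ℕ}
    (hY : Y ⊆ Y') (hx : x' ≤ x) (hM : M' ≤ M) (h : HasPair F Y x M) : HasPair F Y' x' M' := by
  obtain ⟨X, Z, h1, h2, ⟨h3, h4, h5⟩, h6, h7⟩ := h
  obtain ⟨X', hX', hc⟩ := Finset.exists_subset_card_eq (h6 ▸ hx : x' ≤ X.card)
  exact ⟨X', Z, hX'.trans (h1.trans hY), h2.trans hY,
    ⟨Finset.disjoint_of_subset_left hX' h3, fun x hx y hy => h4 x (hX' hx) y (hX' hy),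
      fun x hx => h5 x (hX' hx)⟩, hc, hM.trans h7⟩

theorem PairIn.insert_vertex {V : Type*} [DecidableEq V] {F : SimpleGraph V} {X Z : Finset V} {v : V}
    (hX : ∀ x ∈ X, F.Adj v x) (hZ : ∀ x ∈ Z, F.Adj v x) (h : PairIn F X Z) :
    PairIn F (insert v X) Z := by
  obtain ⟨h3, h4, h5⟩ := h
  refine ⟨?_, ?_, ?_⟩
  · rw [Finset.disjoint_insert_left]
    exact ⟨fun hv => (hZ v hv).ne rfl, h3⟩
  · intro x hx y hy hne
    rw [Finset.mem_insert] at hx hy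
    rcases hx with rfl | hx <;> rcases hy with rfl | hy
    · exact absurd rfl hne
    · exact hX _ hy
    · exact (hX _ hx).symm
    · exact h4 _ hx _ hy hne
  · intro x hx y hy
    rw [Finset.mem_insert] at hx
    rcases hx with rfl | hx
    · exact hZ _ hy
    · exact h5 _ hx _ hy

open Classical in
theorem HasPair.step {V : Type*} {F : SimpleGraph V} {Y : Finset V} {x M : ℕ} {v : V}
    [DecidablePred (F.Adj v)] (hv : v ∈ Y) (h : HasPair F (Y.filter (F.Adj v)) x M) : HasPair F Y (x + 1) M := by
  obtain ⟨X, Z, h1, h2, h3, h6, h7⟩ := h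
  have hX : ∀ x ∈ X, F.Adj v x := fun x hx => (Finset.mem_filter.1 (h1 hx)).2
  have hZ : ∀ x ∈ Z, F.Adj v x := fun x hx => (Finset.mem_filter.1 (h2 hx)).2
  refine ⟨insert v X, Z, ?_, h2.trans (Finset.filter_subset _ _), h3.insert_vertex hX hZ, ?_, h7⟩
  · intro y hy
    rcases Finset.mem_insert.1 hy with rfl | hy
    · exact hv
    · exact (Finset.mem_filter.1 (h1 hy)).1
  · rw [Finset.card_insert_of_notMem (fun hv => (hX v hv).ne rfl), h6]

open Classical in
/-- Erdős–Szekeres for monochromatic pairs. -/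
theorem erdos_szekeres_pair {V : Type*} (F : SimpleGraph V) (M : ℕ) (hM : 1 ≤ M) :
    ∀ k a b : ℕ, a + b = k → ∀ Y : Finset V, (a + b).choose a * M ≤ Y.card →
      HasPair F Y a M ∨ HasPair Fᶜ Y b M := by
  intro k
  induction k with
  | zero =>
    intro a b hab Y hY
    obtain ⟨rfl, rfl⟩ : a = 0 ∧ b = 0 := by omega
    left
    exact ⟨∅, Y, by simp, by simp, ⟨by simp, by simp, by simp⟩, by simp, by simpa using hY⟩
  | succ k ih =>
    intro a b hab Y hY
    rcases a with _ | a
    · left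
      exact ⟨∅, Y, by simp, by simp, ⟨by simp, by simp, by simp⟩, by simp, by simpa using hY⟩
    rcases b with _ | b
    · right
      exact ⟨∅, Y, by simp, by simp, ⟨by simp, by simp, by simp⟩, by simp, by simpa using hY⟩
    have hc : (a + 1 + (b + 1)).choose (a + 1) =
        (a + (b + 1)).choose a + ((a + 1) + b).choose (a + 1) := by
      have : a + 1 + (b + 1) = (a + b + 1) + 1 := by ring
      rw [this, Nat.choose_succ_succ]
      congr 2
      omega
    rw [hc, add_mul] at hY
    have p1 : 1 ≤ (a + (b + 1)).choose a * M :=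
      Nat.mul_pos (Nat.choose_pos (by omega)) hM
    have hpos : 0 < Y.card := by omega
    obtain ⟨v, hv⟩ := Finset.card_pos.1 hpos
    have hsplit : (Y.filter (F.Adj v)).card + (Y.filter (Fᶜ.Adj v)).card + 1 = Y.card := by
      have e1 : (Y.erase v).card + 1 = Y.card := Finset.card_erase_add_one hv
      have e2 := Finset.card_filter_add_card_filter_not (s := Y.erase v) (F.Adj v)
      have e3 : (Y.erase v).filter (F.Adj v) = Y.filter (F.Adj v) := by
        ext w
        simp only [Finset.mem_filter, Finset.mem_erase]
        exact ⟨fun h => ⟨h.1.2, h.2⟩, fun h => ⟨⟨h.2.ne', h.1⟩, h.2⟩⟩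
      have e4 : (Y.erase v).filter (fun w => ¬ F.Adj v w) = Y.filter (Fᶜ.Adj v) := by
        ext w
        simp only [Finset.mem_filter, Finset.mem_erase, SimpleGraph.compl_adj]
        exact ⟨fun h => ⟨h.1.2, Ne.symm h.1.1, h.2⟩, fun h => ⟨⟨h.2.1.symm, h.1⟩, h.2.2⟩⟩
      rw [e3, e4] at e2
      omega
    by_cases h1 : (a + (b + 1)).choose a * M ≤ (Y.filter (F.Adj v)).card
    · rcases ih a (b + 1) (by omega) _ h1 with h | h
      · exact Or.inl (h.step hv)
      · exact Or.inr (h.mono (Finset.filter_subset _ _) le_rfl le_rfl)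
    · have h2 : ((a + 1) + b).choose (a + 1) * M ≤ (Y.filter (Fᶜ.Adj v)).card := by omega
      rcases ih (a + 1) b (by omega) _ h2 with h | h
      · exact Or.inl (h.mono (Finset.filter_subset _ _) le_rfl le_rfl)
      · exact Or.inr (h.step hv)

theorem pow_pred_bound (h q y : ℕ) (hh : 1 ≤ h) (hy : y ≤ q * 2 ^ h) :
    (2 ^ h) ^ y ≤ 4 ^ q * (2 ^ h - 1) ^ y := by
  obtain ⟨e, he⟩ : ∃ e, (2:ℕ) ^ h = 2 * (e + 1) := by
    obtain ⟨k, rfl⟩ : ∃ k, h = k + 1 := ⟨h - 1, by omega⟩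
    have : 0 < (2:ℕ) ^ k := by positivity
    exact ⟨2 ^ k - 1, by rw [pow_succ]; omega⟩
  rw [he] at hy ⊢
  have hd : 2 * (e + 1) - 1 = 2 * e + 1 := by omega
  rw [hd]
  -- Bernoulli
  have b1 : (2 * (e + 1)) ^ (e + 1) ≤ 2 * (2 * e + 1) ^ (e + 1) := by
    have hb := one_add_mul_le_pow (a := (-(1 / (2 * ((e : ℝ) + 1))))) (by
      have : (1 / (2 * ((e : ℝ) + 1))) ≤ 1 := by
        rw [div_le_one (by positivity)]
        have : (0:ℝ) ≤ e := Nat.cast_nonneg e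
        linarith
      linarith) (e + 1)
    have hE : (0:ℝ) < e + 1 := by positivity
    have e1 : (1:ℝ) + ((e + 1 : ℕ) : ℝ) * (-(1 / (2 * ((e : ℝ) + 1)))) = 1 / 2 := by
      push_cast
      field_simp
      ring
    have e2 : (1:ℝ) + -(1 / (2 * ((e : ℝ) + 1))) = (2 * e + 1) / (2 * (e + 1)) := by
      field_simp
      ring
    rw [e1, e2, div_pow, le_div_iff₀ (by positivity)] at hb
    have : ((2 * ((e:ℝ) + 1)) ^ (e + 1)) ≤ 2 * (2 * e + 1) ^ (e + 1) := by linarith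
    exact_mod_cast this
  have b2 : (2 * (e + 1)) ^ (2 * (e + 1)) ≤ 4 * (2 * e + 1) ^ (2 * (e + 1)) := by
    have := Nat.pow_le_pow_left b1 2
    rw [mul_pow 2 ((2 * e + 1) ^ (e + 1)), ← pow_mul, ← pow_mul, mul_comm (e + 1) 2] at this
    simpa using this
  have b3 : (2 * (e + 1)) ^ (q * (2 * (e + 1))) ≤ 4 ^ q * (2 * e + 1) ^ (q * (2 * (e + 1))) := by
    have := Nat.pow_le_pow_left b2 q
    rw [mul_pow 4, ← pow_mul, ← pow_mul, mul_comm (2 * (e + 1)) q] at this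
    exact this
  obtain ⟨z, hz⟩ := Nat.exists_eq_add_of_le hy
  have b4 : (2 * e + 1) ^ z ≤ (2 * (e + 1)) ^ z := Nat.pow_le_pow_left (by omega) z
  rw [hz, pow_add, pow_add] at b3
  have hp : 0 < (2 * e + 1) ^ z := by positivity
  refine Nat.le_of_mul_le_mul_right ?_ hp
  calc (2 * (e + 1)) ^ y * (2 * e + 1) ^ z ≤ (2 * (e + 1)) ^ y * (2 * (e + 1)) ^ z :=
        Nat.mul_le_mul_left _ b4
    _ ≤ _ := by rw [mul_assoc]; exact b3

theorem choose_bound (h q : ℕ) (hh : 1 ≤ h) :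
    (q * 2 ^ h + 2 * q).choose (q * 2 ^ h) ≤ 2 ^ (2 * h * q + 2 * q) := by
  have h1 := pow_pred_bound h q (q * 2 ^ h) hh le_rfl
  obtain ⟨d, hd⟩ : ∃ d, (2:ℕ) ^ h = d + 2 := by
    have : (2:ℕ) ^ 1 ≤ 2 ^ h := Nat.pow_le_pow_right (by norm_num) hh
    exact ⟨2 ^ h - 2, by omega⟩
  have h2 : (q * 2 ^ h + 2 * q).choose (q * 2 ^ h) * (2 ^ h - 1) ^ (q * 2 ^ h) ≤
      (2 ^ h) ^ (q * 2 ^ h + 2 * q) := by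
    have e : (2:ℕ) ^ h = (2 ^ h - 1) + 1 := by omega
    have := add_pow (2 ^ h - 1) 1 (q * 2 ^ h + 2 * q)
    rw [← e] at this
    rw [this]
    have := Finset.single_le_sum (s := Finset.range (q * 2 ^ h + 2 * q + 1))
      (f := fun m => (2 ^ h - 1) ^ m * 1 ^ (q * 2 ^ h + 2 * q - m) *
        (q * 2 ^ h + 2 * q).choose m) (fun _ _ => Nat.zero_le _)
      (Finset.mem_range.2 (by omega : q * 2 ^ h < q * 2 ^ h + 2 * q + 1))
    simp only [one_pow, mul_one] at this ⊢
    rw [mul_comm]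
    exact this
  have hp : 0 < (2 ^ h - 1) ^ (q * 2 ^ h) := Nat.pow_pos (by omega)
  refine Nat.le_of_mul_le_mul_right ?_ hp
  calc _ ≤ (2 ^ h) ^ (q * 2 ^ h + 2 * q) := h2
    _ = (2 ^ h) ^ (2 * q) * (2 ^ h) ^ (q * 2 ^ h) := by rw [pow_add, mul_comm]
    _ ≤ (2 ^ h) ^ (2 * q) * (4 ^ q * (2 ^ h - 1) ^ (q * 2 ^ h)) := Nat.mul_le_mul_left _ h1
    _ = _ := by
      rw [← mul_assoc]
      congr 1
      rw [show (4:ℕ) = 2 ^ 2 by norm_num, ← pow_mul, ← pow_mul, ← pow_add]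
      congr 1
      ring

open Classical in
/-- Pigeonhole on red-neighbourhood patterns. -/
theorem pattern_lemma {V : Type*} (F : SimpleGraph V) (X B : Finset V) (h q : ℕ) (hh : 1 ≤ h)
    (hX : X.card ≤ q * 2 ^ h)
    (hA : ∀ x ∈ X, 2 ^ (h + 1) * (B.filter (F.Adj x)).card ≤ B.card) :
    ∃ X' B' : Finset V, X' ⊆ X ∧ B' ⊆ B ∧ (∀ x ∈ X', ∀ y ∈ B', ¬ F.Adj x y) ∧
      X.card ≤ X'.card + q ∧ B.card ≤ 2 ^ ((h + 2) * q + 1) * B'.card := by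
  rcases Nat.eq_zero_or_pos B.card with hB0 | hBpos
  · exact ⟨X, ∅, le_rfl, by simp, by simp, by omega, by simp [hB0]⟩
  set r : V → Finset V := fun b => X.filter (fun x => F.Adj x b) with hr
  set G0 := B.filter (fun b => (r b).card ≤ q) with hG0
  set Bd := B.filter (fun b => ¬ (r b).card ≤ q) with hBd
  have hsplit : G0.card + Bd.card = B.card := Finset.card_filter_add_card_filter_not _
  have hdc : ∑ b ∈ B, (r b).card = ∑ x ∈ X, (B.filter (F.Adj x)).card := by
    exact (Finset.sum_card_bipartiteAbove_eq_sum_card_bipartiteBelow (s := X) (t := B) F.Adj).symm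
  have hbad : Bd.card * (q + 1) ≤ ∑ b ∈ B, (r b).card := by
    calc Bd.card * (q + 1) = ∑ b ∈ Bd, (q + 1) := by simp
      _ ≤ ∑ b ∈ Bd, (r b).card := Finset.sum_le_sum (fun b hb => by
          have := (Finset.mem_filter.1 hb).2
          omega)
      _ ≤ _ := Finset.sum_le_sum_of_subset (Finset.filter_subset _ _)
  have hup : 2 ^ (h + 1) * ∑ b ∈ B, (r b).card ≤ X.card * B.card := by
    rw [hdc, Finset.mul_sum]
    calc _ ≤ ∑ x ∈ X, B.card := Finset.sum_le_sum hA
      _ = _ := by simp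
  have hP : 0 < (2:ℕ) ^ h := by positivity
  have hhalf : B.card ≤ 2 * G0.card := by
    have h1 : 2 ^ (h + 1) * (Bd.card * (q + 1)) ≤ q * 2 ^ h * B.card :=
      (Nat.mul_le_mul_left _ hbad).trans (hup.trans (Nat.mul_le_mul_right _ hX))
    have h2 : 2 ^ h * (2 * Bd.card * (q + 1)) ≤ 2 ^ h * (B.card * (q + 1)) := by
      calc 2 ^ h * (2 * Bd.card * (q + 1)) = 2 ^ (h + 1) * (Bd.card * (q + 1)) := by ring
        _ ≤ q * 2 ^ h * B.card := h1
        _ = 2 ^ h * (B.card * q) := by ring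
        _ ≤ _ := by gcongr; omega
    have h3 := Nat.le_of_mul_le_mul_left h2 hP
    have h4 := Nat.le_of_mul_le_mul_right h3 (by omega)
    omega
  by_contra hcon
  push Not at hcon
  set Qs := X.powerset.filter (fun Q => Q.card ≤ q) with hQs
  set fib : Finset V → Finset V := fun Q => G0.filter (fun b => r b = Q) with hfib
  have hlt : ∀ Q ∈ Qs, 2 ^ ((h + 2) * q + 1) * (fib Q).card < B.card := by
    intro Q hQ
    rw [hQs, Finset.mem_filter, Finset.mem_powerset] at hQ
    refine hcon (X \ Q) (fib Q) Finset.sdiff_subset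
      ((Finset.filter_subset _ _).trans (Finset.filter_subset _ _)) ?_ ?_
    · intro x hx y hy hadj
      rw [Finset.mem_sdiff] at hx
      have := (Finset.mem_filter.1 hy).2
      apply hx.2
      rw [← this]
      exact Finset.mem_filter.2 ⟨hx.1, hadj⟩
    · have := Finset.card_sdiff_add_card_eq_card hQ.1
      omega
  have hcount : G0.card = ∑ Q ∈ Qs, (fib Q).card := by
    refine Finset.card_eq_sum_card_fiberwise ?_
    intro b hb
    have hb := (Finset.mem_filter.1 hb).2
    exact Finset.mem_filter.2 ⟨Finset.mem_powerset.2 (Finset.filter_subset _ _), hb⟩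
  have hw : ∀ Q ∈ Qs, (2 ^ h) ^ X.card ≤
      2 ^ ((h + 2) * q) * (2 ^ h - 1) ^ (X.card - Q.card) := by
    intro Q hQ
    rw [hQs, Finset.mem_filter, Finset.mem_powerset] at hQ
    have h1 := pow_pred_bound h q (X.card - Q.card) hh (by omega)
    have h2 : X.card = Q.card + (X.card - Q.card) := by
      have := Finset.card_le_card hQ.1
      omega
    calc (2 ^ h) ^ X.card = (2 ^ h) ^ Q.card * (2 ^ h) ^ (X.card - Q.card) := by
          rw [← pow_add, ← h2]
      _ ≤ (2 ^ h) ^ q * (4 ^ q * (2 ^ h - 1) ^ (X.card - Q.card)) :=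
          Nat.mul_le_mul (Nat.pow_le_pow_right hP hQ.2) h1
      _ = _ := by
        rw [← mul_assoc]
        congr 1
        rw [show (4:ℕ) = 2 ^ 2 by norm_num, ← pow_mul, ← pow_mul, ← pow_add]
        congr 1
        ring
  have hd1 : 0 < (2:ℕ) ^ h - 1 := by
    have : (2:ℕ) ^ 1 ≤ 2 ^ h := Nat.pow_le_pow_right (by norm_num) hh
    omega
  have hne : Qs.Nonempty := ⟨∅, by simp [hQs]⟩
  have hfin : 2 * G0.card * (2 ^ h) ^ X.card < B.card * (2 ^ h) ^ X.card := by
    calc 2 * G0.card * (2 ^ h) ^ X.card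
        = ∑ Q ∈ Qs, 2 * (fib Q).card * (2 ^ h) ^ X.card := by
          rw [hcount, Finset.mul_sum, Finset.sum_mul]
      _ ≤ ∑ Q ∈ Qs, (2 ^ ((h + 2) * q + 1) * (fib Q).card) *
            (2 ^ h - 1) ^ (X.card - Q.card) := by
          refine Finset.sum_le_sum (fun Q hQ => ?_)
          calc _ ≤ 2 * (fib Q).card * (2 ^ ((h + 2) * q) * (2 ^ h - 1) ^ (X.card - Q.card)) :=
                Nat.mul_le_mul_left _ (hw Q hQ)
            _ = _ := by rw [pow_succ]; ring
      _ < ∑ Q ∈ Qs, B.card * (2 ^ h - 1) ^ (X.card - Q.card) := by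
          refine Finset.sum_lt_sum_of_nonempty hne (fun Q hQ => ?_)
          exact Nat.mul_lt_mul_of_pos_right (hlt Q hQ) (Nat.pow_pos hd1)
      _ ≤ ∑ Q ∈ X.powerset, B.card * (2 ^ h - 1) ^ (X.card - Q.card) :=
          Finset.sum_le_sum_of_subset (Finset.filter_subset _ _)
      _ = B.card * (2 ^ h) ^ X.card := by
          rw [← Finset.mul_sum]
          congr 1
          have := Finset.sum_pow_mul_eq_add_pow 1 (2 ^ h - 1) X
          simp only [one_pow, one_mul] at this
          rw [this]
          congr 1
          omega
  have := Nat.lt_of_mul_lt_mul_right hfin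
  omega

open Classical in
/-- Greedy embedding. -/
theorem embed_lemma {α V : Type*} [Fintype α] (G : SimpleGraph α) (S : Finset α)
    (F : SimpleGraph V) (Y : Finset V) (p D θ : ℕ) (hD : 1 ≤ D)
    (hdeg : ∀ v ∈ S, (Finset.univ.filter (G.Adj v)).card ≤ D)
    (hθ : Fintype.card α ≤ θ)  (hθ1 : 1 ≤ θ)
    (hY : 2 ^ ((p + 1) * D) * θ ≤ Y.card)
    (hdense : ∀ A ⊆ Y, ∀ B ⊆ Y, θ ≤ A.card → θ ≤ B.card →
      ∃ w ∈ A, B.card ≤ 2 ^ p * (B.filter (F.Adj w)).card) : EmbIn G S F Y := by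
  have hYpos : 0 < Y.card := lt_of_lt_of_le (by positivity) hY
  obtain ⟨y0, hy0⟩ := Finset.card_pos.1 hYpos
  suffices H : ∀ U : Finset α, U ⊆ S → ∃ f : α → V, Set.InjOn f U ∧ (∀ a ∈ U, f a ∈ Y) ∧
      (∀ a ∈ U, ∀ b ∈ U, G.Adj a b → F.Adj (f a) (f b)) ∧
      ∀ v ∈ S, v ∉ U → Y.card ≤ 2 ^ (p * (U.filter (G.Adj v)).card) *
        (Y.filter (fun y => ∀ u ∈ U, G.Adj v u → F.Adj (f u) y)).card by
    obtain ⟨f, h1, h2, h3, _⟩ := H S le_rfl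
    exact ⟨f, h1, h2, h3⟩
  intro U
  induction U using Finset.induction_on with
  | empty =>
    intro _
    exact ⟨fun _ => y0, by simp, by simp, by simp, by simp⟩
  | insert v U hvU ih =>
    intro hUS
    have hvS : v ∈ S := hUS (Finset.mem_insert_self _ _)
    obtain ⟨f, h1, h2, h3, h4⟩ := ih ((Finset.subset_insert _ _).trans hUS)
    set C : α → Finset V := fun u => Y.filter (fun y => ∀ a ∈ U, G.Adj u a → F.Adj (f a) y) with hC
    have hCbig : ∀ u ∈ S, u ∉ U → 2 ^ D * θ ≤ (C u).card := by
      intro u hu huU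
      have e1 := h4 u hu huU
      have e2 : (U.filter (G.Adj u)).card ≤ D :=
        (Finset.card_le_card (Finset.filter_subset_filter _ (Finset.subset_univ _))).trans
          (hdeg u hu)
      have e3 : 2 ^ (p * D) * (2 ^ D * θ) ≤ 2 ^ (p * D) * (C u).card := by
        calc 2 ^ (p * D) * (2 ^ D * θ) = 2 ^ ((p + 1) * D) * θ := by
              rw [← mul_assoc, ← pow_add]; congr 2; ring
          _ ≤ Y.card := hY
          _ ≤ _ := e1
          _ ≤ _ := Nat.mul_le_mul_right _ (Nat.pow_le_pow_right (by norm_num)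
              (Nat.mul_le_mul_left _ e2))
      exact Nat.le_of_mul_le_mul_left e3 (by positivity)
    have h2D : D + 1 ≤ 2 ^ D := Nat.lt_two_pow_self
    have hCθ : ∀ u ∈ S, u ∉ U → θ ≤ (C u).card := fun u hu huU =>
      le_trans (Nat.le_mul_of_pos_left _ (by positivity)) (hCbig u hu huU)
    set Nv := (S \ insert v U).filter (G.Adj v) with hNv
    have hNvD : Nv.card ≤ D :=
      (Finset.card_le_card (Finset.filter_subset_filter _ (Finset.subset_univ _))).trans
        (hdeg v hvS)
    set bad : α → Finset V := fun u =>
      (C v).filter (fun w => ¬ (C u).card ≤ 2 ^ p * ((C u).filter (F.Adj w)).card) with hbad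
    have hbadc : ∀ u ∈ Nv, (bad u).card ≤ θ - 1 := by
      intro u hu
      by_contra hlt
      rw [hNv, Finset.mem_filter, Finset.mem_sdiff, Finset.mem_insert] at hu
      obtain ⟨w, hw, hw2⟩ := hdense (bad u)
        ((Finset.filter_subset _ _).trans (Finset.filter_subset _ _)) (C u)
        (Finset.filter_subset _ _) (by omega) (hCθ u hu.1.1 (fun h => hu.1.2 (Or.inr h)))
      exact (Finset.mem_filter.1 hw).2 hw2
    have hUcard : U.card < θ := by
      have : (insert v U).card ≤ Fintype.card α := Finset.card_le_univ _
      rw [Finset.card_insert_of_notMem hvU] at this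
      omega
    have hex : ∃ w ∈ C v, w ∉ U.image f ∪ Nv.biUnion bad := by
      apply Finset.exists_mem_notMem_of_card_lt_card
      calc _ ≤ (U.image f).card + (Nv.biUnion bad).card := Finset.card_union_le _ _
        _ ≤ U.card + Nv.card * (θ - 1) :=
          add_le_add Finset.card_image_le (Finset.card_biUnion_le_card_mul _ _ _ hbadc)
        _ < θ + D * θ :=
          add_lt_add_of_lt_of_le hUcard (Nat.mul_le_mul hNvD (by omega))
        _ = (D + 1) * θ := by ring
        _ ≤ 2 ^ D * θ := Nat.mul_le_mul_right _ h2D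
        _ ≤ _ := hCbig v hvS hvU
    obtain ⟨w, hwC, hwn⟩ := hex
    rw [Finset.mem_union, not_or] at hwn
    obtain ⟨hw1, hw2⟩ := hwn
    have hfu : ∀ u ∈ U, Function.update f v w u = f u := fun u hu =>
      Function.update_of_ne (by rintro rfl; exact hvU hu) _ _
    have hwY := (Finset.mem_filter.1 hwC).1
    have hwA := (Finset.mem_filter.1 hwC).2
    refine ⟨Function.update f v w, ?_, ?_, ?_, ?_⟩
    · intro a ha b hb hab
      rw [Finset.mem_coe, Finset.mem_insert] at ha hb
      rcases ha with rfl | ha <;> rcases hb with rfl | hb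
      · rfl
      · rw [Function.update_self, hfu b hb] at hab
        exact absurd (Finset.mem_image.2 ⟨b, hb, hab.symm⟩) hw1
      · rw [Function.update_self, hfu a ha] at hab
        exact absurd (Finset.mem_image.2 ⟨a, ha, hab⟩) hw1
      · rw [hfu a ha, hfu b hb] at hab
        exact h1 ha hb hab
    · intro a ha
      rw [Finset.mem_insert] at ha
      rcases ha with rfl | ha
      · rwa [Function.update_self]
      · rw [hfu a ha]; exact h2 a ha
    · intro a ha b hb hab
      rw [Finset.mem_insert] at ha hb
      rcases ha with rfl | ha <;> rcases hb with rfl | hb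
      · exact absurd hab (G.loopless.irrefl _)
      · rw [Function.update_self, hfu b hb]
        exact (hwA b hb hab).symm
      · rw [Function.update_self, hfu a ha]
        exact hwA a ha hab.symm
      · rw [hfu a ha, hfu b hb]
        exact h3 a ha b hb hab
    · intro u hu huU
      have huU' : u ∉ U := fun h => huU (Finset.mem_insert_of_mem h)
      have e1 := h4 u hu huU'
      by_cases hadj : G.Adj u v
      · have huN : u ∈ Nv := by
          rw [hNv, Finset.mem_filter, Finset.mem_sdiff]
          exact ⟨⟨hu, huU⟩, hadj.symm⟩
        have e2 : (C u).card ≤ 2 ^ p * ((C u).filter (F.Adj w)).card := by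
          by_contra hc
          exact hw2 (Finset.mem_biUnion.2 ⟨u, huN, Finset.mem_filter.2 ⟨hwC, hc⟩⟩)
        have e3 : (insert v U).filter (G.Adj u) = insert v (U.filter (G.Adj u)) := by
          rw [Finset.filter_insert, if_pos hadj]
        have e4 : ((insert v U).filter (G.Adj u)).card = (U.filter (G.Adj u)).card + 1 := by
          rw [e3, Finset.card_insert_of_notMem (fun h => hvU (Finset.mem_filter.1 h).1)]
        have e5 : (C u).filter (F.Adj w) ⊆ Y.filter (fun y => ∀ a ∈ insert v U,
            G.Adj u a → F.Adj (Function.update f v w a) y) := by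
          intro y hy
          rw [Finset.mem_filter, hC, Finset.mem_filter] at hy
          refine Finset.mem_filter.2 ⟨hy.1.1, fun a ha hua => ?_⟩
          rw [Finset.mem_insert] at ha
          rcases ha with rfl | ha
          · rw [Function.update_self]; exact hy.2
          · rw [hfu a ha]; exact hy.1.2 a ha hua
        rw [e4]
        calc Y.card ≤ 2 ^ (p * (U.filter (G.Adj u)).card) * (C u).card := e1
          _ ≤ 2 ^ (p * (U.filter (G.Adj u)).card) * (2 ^ p * ((C u).filter (F.Adj w)).card) :=
            Nat.mul_le_mul_left _ e2
          _ = 2 ^ (p * ((U.filter (G.Adj u)).card + 1)) * ((C u).filter (F.Adj w)).card := by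
            rw [← mul_assoc, ← pow_add, mul_add, mul_one]
          _ ≤ _ := Nat.mul_le_mul_left _ (Finset.card_le_card e5)
      · have e3 : (insert v U).filter (G.Adj u) = U.filter (G.Adj u) := by
          rw [Finset.filter_insert, if_neg hadj]
        have e5 : C u ⊆ Y.filter (fun y => ∀ a ∈ insert v U,
            G.Adj u a → F.Adj (Function.update f v w a) y) := by
          intro y hy
          rw [hC, Finset.mem_filter] at hy
          refine Finset.mem_filter.2 ⟨hy.1, fun a ha hua => ?_⟩
          rw [Finset.mem_insert] at ha
          rcases ha with rfl | ha
          · exact absurd hua hadj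
          · rw [hfu a ha]; exact hy.2 a ha hua
        rw [e3]
        exact e1.trans (Nat.mul_le_mul_left _ (Finset.card_le_card e5))

open Classical in
/-- The recursive step: no copy of the low degree part gives a long monochromatic pair. -/
theorem stage_lemma {α V : Type*} [Fintype α] (G : SimpleGraph α) (S : Finset α)
    (F : SimpleGraph V) (D q h M : ℕ) (hD : 1 ≤ D) (hh : 1 ≤ h)
    (hdeg : ∀ v ∈ S, (Finset.univ.filter (G.Adj v)).card ≤ D)
    (hM1 : 1 ≤ M) (hMα : Fintype.card α ≤ M) (hMq : q * 2 ^ h ≤ M) :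
    ∀ j ≤ h, ∀ Y : Finset V, ¬ EmbIn G S F Y →
      2 ^ (j * ((h + 2) * D + (h + 2) * q + 2) + (2 * h * q + 2 * q)) * M ≤ Y.card →
      HasPair F Y (q * 2 ^ h) M ∨ HasPair Fᶜ Y (q * (1 + 2 ^ j)) M := by
  intro j
  induction j with
  | zero =>
    intro _ Y _ hY
    have := erdos_szekeres_pair F M hM1 _ (q * 2 ^ h) (2 * q) rfl Y
      (le_trans (Nat.mul_le_mul_right _ (choose_bound h q hh)) (by simpa using hY))
    rwa [show q * (1 + 2 ^ 0) = 2 * q by ring]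
  | succ j ih =>
    intro hj Y hemb hY
    set f := 2 ^ (j * ((h + 2) * D + (h + 2) * q + 2) + (2 * h * q + 2 * q)) with hf
    have hf1 : 1 ≤ f := Nat.one_le_two_pow
    set θ := 2 ^ ((h + 2) * q + 2) * (f * M) with hθ
    have hfMθ : f * M ≤ θ := Nat.le_mul_of_pos_left _ (by positivity)
    have hMf : M ≤ f * M := Nat.le_mul_of_pos_left _ hf1
    have hYθ : 2 ^ ((h + 1 + 1) * D) * θ ≤ Y.card := by
      refine le_trans (le_of_eq ?_) hY
      rw [hθ, hf, ← mul_assoc, ← mul_assoc, ← pow_add, ← pow_add]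
      congr 2
      ring
    have hfail : ¬ ∀ A ⊆ Y, ∀ B ⊆ Y, θ ≤ A.card → θ ≤ B.card →
        ∃ w ∈ A, B.card ≤ 2 ^ (h + 1) * (B.filter (F.Adj w)).card := fun hd =>
      hemb (embed_lemma G S F Y (h + 1) D θ hD hdeg (by omega) (by omega) hYθ hd)
    push Not at hfail
    obtain ⟨A, hA, B, hB, hAc, hBc, hAB⟩ := hfail
    rcases ih (by omega) A (fun h => hemb (h.mono hA)) (hfMθ.trans hAc) with h1 | h1
    · exact Or.inl (h1.mono hA le_rfl le_rfl)
    obtain ⟨X1, Z1, hX1, -, ⟨-, hX1c, -⟩, hX1card, -⟩ := h1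
    have hpow : 1 + 2 ^ j ≤ 2 ^ h := by
      have h1 : (2:ℕ) ^ (j + 1) ≤ 2 ^ h := Nat.pow_le_pow_right (by norm_num) hj
      have h2 : 1 ≤ (2:ℕ) ^ j := Nat.one_le_two_pow
      rw [pow_succ] at h1
      omega
    have hX1le : X1.card ≤ q * 2 ^ h := by
      rw [hX1card]; exact Nat.mul_le_mul_left _ hpow
    obtain ⟨X', B', hX', hB', hnon, hXq, hBB⟩ :=
      pattern_lemma F X1 B h q hh hX1le (fun x hx => (hAB x (hX1 hx)).le)
    have hB'big : 2 * (f * M) ≤ B'.card := by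
      have : 2 ^ ((h + 2) * q + 1) * (2 * (f * M)) ≤ 2 ^ ((h + 2) * q + 1) * B'.card := by
        refine le_trans (le_of_eq ?_) (hBc.trans hBB)
        rw [hθ, pow_succ, pow_succ, pow_succ]; ring
      exact Nat.le_of_mul_le_mul_left this (by positivity)
    have hB2 : f * M ≤ (B' \ X1).card := by
      have := Finset.le_card_sdiff X1 B'
      omega
    have hB2Y : B' \ X1 ⊆ Y := Finset.sdiff_subset.trans (hB'.trans hB)
    rcases ih (by omega) (B' \ X1) (fun h => hemb (h.mono hB2Y)) hB2 with h2 | h2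
    · exact Or.inl (h2.mono hB2Y le_rfl le_rfl)
    right
    obtain ⟨X2, Z2, hX2, hZ2, ⟨hd2, hX2c, hXZ2⟩, hX2card, hZ2c⟩ := h2
    have hcross : ∀ x ∈ X', ∀ y ∈ B' \ X1, Fᶜ.Adj x y := by
      intro x hx y hy
      rw [Finset.mem_sdiff] at hy
      rw [SimpleGraph.compl_adj]
      exact ⟨fun h => hy.2 (h ▸ hX' hx), hnon x hx y hy.1⟩
    have hdisj : Disjoint X' (B' \ X1) :=
      Finset.disjoint_of_subset_left hX' Finset.disjoint_sdiff
    have hres : HasPair Fᶜ Y (X' ∪ X2).card M := by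
      refine ⟨X' ∪ X2, Z2, ?_, hZ2.trans hB2Y, ⟨?_, ?_, ?_⟩, rfl, hZ2c⟩
      · exact Finset.union_subset (hX'.trans (hX1.trans hA)) (hX2.trans hB2Y)
      · rw [Finset.disjoint_union_left]
        exact ⟨Finset.disjoint_of_subset_right hZ2 hdisj, hd2⟩
      · intro x hx y hy hne
        rw [Finset.mem_union] at hx hy
        rcases hx with hx | hx <;> rcases hy with hy | hy
        · exact hX1c x (hX' hx) y (hX' hy) hne
        · exact hcross x hx y (hX2 hy)
        · exact (hcross y hy x (hX2 hx)).symm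
        · exact hX2c x hx y hy hne
      · intro x hx y hy
        rw [Finset.mem_union] at hx
        rcases hx with hx | hx
        · exact hcross x hx y (hZ2 hy)
        · exact hXZ2 x hx y hy
    refine hres.mono le_rfl ?_ le_rfl
    rw [Finset.card_union_of_disjoint (Finset.disjoint_of_subset_right hX2 hdisj), hX2card]
    have : q * (1 + 2 ^ (j + 1)) + q = q * (1 + 2 ^ j) + q * (1 + 2 ^ j) := by
      rw [pow_succ]; ring
    omega

open Classical in
theorem step_lemma {α V : Type*} [Fintype α] [Fintype V] (G : SimpleGraph α)
    (F : SimpleGraph V) (s i e : ℕ) (hs : 1 ≤ s)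
    (hsum : ∑ v, (Finset.univ.filter (G.Adj v)).card ≤ 2 * s ^ 2)
    (hpos : ∀ v, 1 ≤ (Finset.univ.filter (G.Adj v)).card)
    (hinv : (35 * i ^ 2 + 190 * i + 276) * s + 8 * s * 2 ^ i ≤ e * 2 ^ i)
    (hpair : HasPair F Finset.univ (2 ^ i * s) (2 ^ e)) (hno : ¬ IsCopyIn G F) :
    2 ^ i < 2 * s ∧ ∃ e', (35 * (i + 4) ^ 2 + 190 * (i + 4) + 276) * s + 8 * s * 2 ^ (i + 4)
        ≤ e' * 2 ^ (i + 4) ∧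
      (HasPair F Finset.univ (2 ^ (i + 4) * s) (2 ^ e') ∨
        HasPair Fᶜ Finset.univ (2 ^ (i + 4) * s) (2 ^ e')) := by
  obtain ⟨X, Z, -, -, ⟨hdisj, hXX, hXZ⟩, hXc, hZc⟩ := hpair
  have hcard : Fintype.card α ≤ 2 * s ^ 2 := by
    calc Fintype.card α = ∑ v : α, 1 := by simp
      _ ≤ _ := Finset.sum_le_sum (fun v _ => hpos v)
      _ ≤ _ := hsum
  -- gluing
  have glue : ∀ S : Finset α, (Finset.univ \ S).card ≤ X.card → ¬ EmbIn G S F Z := by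
    rintro S hS ⟨f, f1, f2, f3⟩
    obtain ⟨X', hX', hX'c⟩ := Finset.exists_subset_card_eq hS
    have eqv : (Finset.univ \ S : Finset α) ≃ X' := Finset.equivOfCardEq hX'c.symm
    let g : α → V := fun a => if h : a ∈ (Finset.univ \ S : Finset α) then (eqv ⟨a, h⟩ : V) else f a
    have gS : ∀ a ∈ S, g a = f a := by
      intro a ha
      simp [g, ha]
    have gT : ∀ a, a ∉ S → g a ∈ X := by
      intro a ha
      have h : a ∈ (Finset.univ \ S : Finset α) := by simp [ha]
      simp only [g, dif_pos h]
      exact hX' (eqv ⟨a, h⟩).2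
    have gTinj : ∀ a b, a ∉ S → b ∉ S → g a = g b → a = b := by
      intro a b ha hb hab
      have h : a ∈ (Finset.univ \ S : Finset α) := by simp [ha]
      have h' : b ∈ (Finset.univ \ S : Finset α) := by simp [hb]
      simp only [g, dif_pos h, dif_pos h'] at hab
      have := eqv.injective (Subtype.ext hab)
      exact congrArg Subtype.val this
    have gZ : ∀ a ∈ S, g a ∈ Z := fun a ha => gS a ha ▸ f2 a ha
    have ginj : Function.Injective g := by
      intro a b hab
      by_cases ha : a ∈ S <;> by_cases hb : b ∈ S
      · rw [gS a ha, gS b hb] at hab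
        exact f1 ha hb hab
      · exact absurd (hab ▸ gZ a ha) (Finset.disjoint_left.1 hdisj (gT b hb))
      · exact absurd (hab ▸ gZ b hb) (Finset.disjoint_left.1 hdisj (gT a ha))
      · exact gTinj a b ha hb hab
    refine hno ⟨⟨g, ginj⟩, fun a b hab => ?_⟩
    change F.Adj (g a) (g b)
    by_cases ha : a ∈ S <;> by_cases hb : b ∈ S
    · rw [gS a ha, gS b hb]
      exact f3 a ha b hb hab
    · exact (hXZ _ (gT b hb) _ (gZ a ha)).symm
    · exact hXZ _ (gT a ha) _ (gZ b hb)
    · exact hXX _ (gT a ha) _ (gT b hb) (fun h => hab.ne (ginj h))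
  have hZne : Z.Nonempty := Finset.card_pos.1 (lt_of_lt_of_le (by positivity) hZc)
  have hi : 2 ^ i < 2 * s := by
    by_contra hcon
    push Not at hcon
    refine glue ∅ ?_ ⟨fun _ => hZne.choose, by simp, by simp, by simp⟩
    rw [hXc, Finset.sdiff_empty, Finset.card_univ]
    refine hcard.trans ?_
    calc 2 * s ^ 2 = 2 * s * s := by ring
      _ ≤ _ := Nat.mul_le_mul_right _ hcon
  refine ⟨hi, ?_⟩
  have hPi : 0 < 2 ^ i := by positivity
  obtain ⟨D, hD1, hDlow, hDup⟩ : ∃ D, 1 ≤ D ∧ 2 * s ≤ D * 2 ^ i ∧ D * 2 ^ i ≤ 4 * s := by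
    refine ⟨2 * s / 2 ^ i + 1, Nat.le_add_left _ _, ?_, ?_⟩
    · have := Nat.lt_div_mul_add (a := 2 * s) hPi
      rw [add_mul]; omega
    · have := Nat.div_mul_le_self (2 * s) (2 ^ i)
      rw [add_mul]; omega
  set S := Finset.univ.filter (fun v => (Finset.univ.filter (G.Adj v)).card ≤ D) with hS
  have hT : (Finset.univ \ S).card ≤ X.card := by
    have h1 : (Finset.univ \ S).card * D ≤ 2 * s ^ 2 := by
      calc _ = ∑ v ∈ Finset.univ \ S, D := by simp
        _ ≤ ∑ v ∈ Finset.univ \ S, (Finset.univ.filter (G.Adj v)).card := by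
          refine Finset.sum_le_sum (fun v hv => ?_)
          have : v ∉ S := (Finset.mem_sdiff.1 hv).2
          rw [hS, Finset.mem_filter] at this
          by_contra hc
          exact this ⟨Finset.mem_univ _, by omega⟩
        _ ≤ _ := Finset.sum_le_sum_of_subset (Finset.subset_univ _)
        _ ≤ _ := hsum
    rw [hXc]
    have h2 : (Finset.univ \ S).card * (2 * s) ≤ (2 ^ i * s) * (2 * s) := by
      calc _ ≤ (Finset.univ \ S).card * (D * 2 ^ i) := Nat.mul_le_mul_left _ hDlow
        _ = (Finset.univ \ S).card * D * 2 ^ i := by ring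
        _ ≤ 2 * s ^ 2 * 2 ^ i := Nat.mul_le_mul_right _ h1
        _ = _ := by ring
    exact Nat.le_of_mul_le_mul_right h2 (by omega)
  have hemb := glue S hT
  obtain ⟨K, hK⟩ : ∃ K, K = (2 * i + 3) * ((2 * i + 3 + 2) * D + (2 * i + 3 + 2) * D + 2) +
    (2 * (2 * i + 3) * D + 2 * D) := ⟨_, rfl⟩
  have hKb : K * 2 ^ i ≤ (32 * i ^ 2 + 160 * i + 176) * s := by
    have h1 : K ≤ D * (8 * i ^ 2 + 40 * i + 44) := by
      rw [hK]
      nlinarith [Nat.mul_le_mul_left i hD1]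
    calc K * 2 ^ i ≤ D * (8 * i ^ 2 + 40 * i + 44) * 2 ^ i := Nat.mul_le_mul_right _ h1
      _ = (D * 2 ^ i) * (8 * i ^ 2 + 40 * i + 44) := by ring
      _ ≤ (4 * s) * (8 * i ^ 2 + 40 * i + 44) := Nat.mul_le_mul_right _ hDup
      _ = _ := by ring
  have hKe : K ≤ e := by
    refine Nat.le_of_mul_le_mul_right (hKb.trans (le_trans ?_ hinv)) hPi
    refine le_trans (Nat.mul_le_mul_right _ ?_) (Nat.le_add_right _ _)
    nlinarith
  obtain ⟨e', he'⟩ := Nat.exists_eq_add_of_le hKe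
  have hinv' : (35 * (i + 4) ^ 2 + 190 * (i + 4) + 276) * s + 8 * s * 2 ^ (i + 4)
        ≤ e' * 2 ^ (i + 4) := by
    have h1 : e * 2 ^ i = K * 2 ^ i + e' * 2 ^ i := by rw [he']; ring
    have h2 : (3 * i ^ 2 + 30 * i + 100) * s + 8 * s * 2 ^ i ≤ e' * 2 ^ i := by
      have : (35 * i ^ 2 + 190 * i + 276) * s =
        (3 * i ^ 2 + 30 * i + 100) * s + (32 * i ^ 2 + 160 * i + 176) * s := by ring
      omega
    have h3 : (35 * (i + 4) ^ 2 + 190 * (i + 4) + 276) * s ≤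
        16 * ((3 * i ^ 2 + 30 * i + 100) * s) := by
      rw [← mul_assoc]
      refine Nat.mul_le_mul_right _ ?_
      nlinarith
    have h4 : e' * 2 ^ (i + 4) = 16 * (e' * 2 ^ i) := by rw [pow_add]; ring
    have h5 : 8 * s * 2 ^ (i + 4) = 16 * (8 * s * 2 ^ i) := by rw [pow_add]; ring
    omega
  refine ⟨e', hinv', ?_⟩
  have he8 : 8 * s ≤ e' :=
    Nat.le_of_mul_le_mul_right ((Nat.le_add_left _ _).trans hinv') (by positivity)
  have hbig : 64 * s ^ 2 ≤ 2 ^ e' := by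
    have h1 : s ≤ 2 ^ s := Nat.lt_two_pow_self.le
    calc 64 * s ^ 2 ≤ 2 ^ (6 * s) * (2 ^ s) ^ 2 :=
          Nat.mul_le_mul (by
            calc 64 = 2 ^ 6 := by norm_num
              _ ≤ _ := Nat.pow_le_pow_right (by norm_num) (by omega)) (Nat.pow_le_pow_left h1 2)
      _ = 2 ^ (8 * s) := by rw [← pow_mul, ← pow_add]; congr 1; ring
      _ ≤ _ := Nat.pow_le_pow_right (by norm_num) he8
  have hDh : D * 2 ^ (2 * i + 3) = (D * 2 ^ i) * (8 * 2 ^ i) := by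
    rw [pow_add, two_mul, pow_add]; ring
  have hst := stage_lemma G S F D D (2 * i + 3) (2 ^ e') hD1 (by omega)
    (fun v hv => (Finset.mem_filter.1 hv).2) Nat.one_le_two_pow (by nlinarith)
    (by
      rw [hDh]
      calc _ ≤ (4 * s) * (8 * (2 * s)) := Nat.mul_le_mul hDup (by omega)
        _ = 64 * s ^ 2 := by ring
        _ ≤ _ := hbig) (2 * i + 3) le_rfl Z hemb
    (by rw [← hK, ← pow_add, ← he']; exact hZc)
  have hx : 2 ^ (i + 4) * s ≤ D * 2 ^ (2 * i + 3) := by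
    rw [hDh]
    calc _ = (2 * s) * (8 * 2 ^ i) := by rw [pow_add]; ring
      _ ≤ _ := Nat.mul_le_mul_right _ hDlow
  rcases hst with h | h
  · exact Or.inl (h.mono (Finset.subset_univ _) hx le_rfl)
  · exact Or.inr (h.mono (Finset.subset_univ _)
      (hx.trans (Nat.mul_le_mul_left _ (by omega))) le_rfl)

open Classical in
theorem main_induction {α β V : Type*} [Fintype α] [Fintype β] [Fintype V]
    (G₁ : SimpleGraph α) (G₂ : SimpleGraph β) (F : SimpleGraph V) (s : ℕ) (hs : 1 ≤ s)
    (hsum₁ : ∑ v, (Finset.univ.filter (G₁.Adj v)).card ≤ 2 * s ^ 2)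
    (hpos₁ : ∀ v, 1 ≤ (Finset.univ.filter (G₁.Adj v)).card)
    (hsum₂ : ∑ v, (Finset.univ.filter (G₂.Adj v)).card ≤ 2 * s ^ 2)
    (hpos₂ : ∀ v, 1 ≤ (Finset.univ.filter (G₂.Adj v)).card)
    (hno₁ : ¬ IsCopyIn G₁ F) (hno₂ : ¬ IsCopyIn G₂ Fᶜ) :
    ∀ k i e : ℕ, 2 * s ≤ i + k →
      (35 * i ^ 2 + 190 * i + 276) * s + 8 * s * 2 ^ i ≤ e * 2 ^ i →
      ¬ (HasPair F Finset.univ (2 ^ i * s) (2 ^ e) ∨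
        HasPair Fᶜ Finset.univ (2 ^ i * s) (2 ^ e)) := by
  intro k
  induction k with
  | zero =>
    intro i e hk hinv hp
    have hi : i < 2 ^ i := Nat.lt_two_pow_self
    rcases hp with hp | hp
    · have := (step_lemma G₁ F s i e hs hsum₁ hpos₁ hinv hp hno₁).1
      omega
    · have := (step_lemma G₂ Fᶜ s i e hs hsum₂ hpos₂ hinv hp hno₂).1
      omega
  | succ k ih =>
    intro i e hk hinv hp
    rcases hp with hp | hp
    · obtain ⟨-, e', h1, h2⟩ := step_lemma G₁ F s i e hs hsum₁ hpos₁ hinv hp hno₁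
      exact ih (i + 4) e' (by omega) h1 h2
    · obtain ⟨-, e', h1, h2⟩ := step_lemma G₂ Fᶜ s i e hs hsum₂ hpos₂ hinv hp hno₂
      rw [compl_compl] at h2
      exact ih (i + 4) e' (by omega) h1 h2.symm

open Classical in
theorem degree_facts {α : Type*} [Fintype α] (G : SimpleGraph α)
    (hiso : ∀ v : α, (G.neighborSet v).Nonempty) :
    ∑ v, (Finset.univ.filter (G.Adj v)).card = 2 * G.edgeSet.ncard ∧
      ∀ v, 1 ≤ (Finset.univ.filter (G.Adj v)).card := by
  have h1 : ∀ v, (Finset.univ.filter (G.Adj v)).card = G.degree v := by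
    intro v
    rw [← SimpleGraph.card_neighborFinset_eq_degree, SimpleGraph.neighborFinset_eq_filter]
  refine ⟨?_, fun v => ?_⟩
  · simp only [h1]
    rw [SimpleGraph.sum_degrees_eq_twice_card_edges, Set.ncard_eq_toFinset_card']
    rfl
  · obtain ⟨w, hw⟩ := hiso v
    exact Finset.card_pos.2 ⟨w, Finset.mem_filter.2 ⟨Finset.mem_univ _, hw⟩⟩

theorem ramseyProp_of_edges {α β : Type*} [Fintype α] [Fintype β]
    (G₁ : SimpleGraph α) (G₂ : SimpleGraph β)
    (hiso₁ : ∀ v : α, (G₁.neighborSet v).Nonempty)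
    (hiso₂ : ∀ v : β, (G₂.neighborSet v).Nonempty)
    (s : ℕ) (hs : 1 ≤ s) (h₁ : G₁.edgeSet.ncard ≤ s ^ 2) (h₂ : G₂.edgeSet.ncard ≤ s ^ 2) :
    RamseyProp G₁ G₂ (2 ^ (138 * s)) := by
  classical
  intro F
  by_contra hcon
  rw [not_or] at hcon
  obtain ⟨d1, d2⟩ := degree_facts G₁ hiso₁
  obtain ⟨d3, d4⟩ := degree_facts G₂ hiso₂
  have hE := erdos_szekeres_pair F (2 ^ (74 * s)) Nat.one_le_two_pow _ (2 ^ 5 * s) (2 ^ 5 * s) rfl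
    Finset.univ (by
      rw [Finset.card_univ, Fintype.card_fin]
      calc _ ≤ 2 ^ (2 ^ 5 * s + 2 ^ 5 * s) * 2 ^ (74 * s) :=
            Nat.mul_le_mul_right _ (Nat.choose_le_two_pow _ _)
        _ = 2 ^ (138 * s) := by rw [← pow_add]; congr 1; ring)
  exact main_induction G₁ G₂ F s hs (by omega) d2 (by omega) d4 hcon.1 hcon.2 (2 * s) 5 (74 * s)
    (by omega) (by omega) hE

/-- Corollary: off-diagonal Erdős conjecture bound. -/
theorem ramsey_le_two_pow_sqrt_max_edges {α β : Type*} [Fintype α] [Fintype β]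
    (G₁ : SimpleGraph α) (G₂ : SimpleGraph β)
    (hiso₁ : ∀ v : α, (G₁.neighborSet v).Nonempty)
    (hiso₂ : ∀ v : β, (G₂.neighborSet v).Nonempty)
    (m : ℕ) (hm : m = max G₁.edgeSet.ncard G₂.edgeSet.ncard) :
    (ramsey G₁ G₂ : ℝ) ≤ 2 ^ (250 * Real.sqrt m) := by
  by_cases hm0 : m = 0
  · have h0 : G₁.edgeSet.ncard = 0 := by
      have := le_max_left G₁.edgeSet.ncard G₂.edgeSet.ncard
      omega
    have hα : IsEmpty α := by
      classical
      refine ⟨fun a => ?_⟩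
      obtain ⟨d1, d2⟩ := degree_facts G₁ hiso₁
      rw [h0, mul_zero, Finset.sum_eq_zero_iff] at d1
      have := d1 a (Finset.mem_univ _)
      have := d2 a
      omega
    have h1 : ramsey G₁ G₂ ≤ 1 := Nat.sInf_le ⟨one_pos, fun F =>
      Or.inl ⟨⟨fun a => (hα.false a).elim, fun a => (hα.false a).elim⟩,
        fun a => (hα.false a).elim⟩⟩
    subst hm0
    simpa using h1
  have hm1 : 1 ≤ m := Nat.one_le_iff_ne_zero.2 hm0
  have hmr : (1:ℝ) ≤ m := by exact_mod_cast hm1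
  have hsq : (1:ℝ) ≤ Real.sqrt m := Real.one_le_sqrt.2 hmr
  obtain ⟨s, hs⟩ : ∃ s, s = ⌈Real.sqrt m⌉₊ := ⟨_, rfl⟩
  have hle : Real.sqrt m ≤ s := hs ▸ Nat.le_ceil _
  have hs1 : 1 ≤ s := by
    have : (1:ℝ) ≤ s := hsq.trans hle
    exact_mod_cast this
  have hms : m ≤ s ^ 2 := by
    have : (m:ℝ) ≤ (s:ℝ) ^ 2 := by
      rw [← Real.sq_sqrt (Nat.cast_nonneg m)]
      exact pow_le_pow_left₀ (Real.sqrt_nonneg _) hle 2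
    exact_mod_cast this
  have hR : ramsey G₁ G₂ ≤ 2 ^ (138 * s) := Nat.sInf_le ⟨by positivity,
    ramseyProp_of_edges G₁ G₂ hiso₁ hiso₂ s hs1
      ((le_max_left _ _).trans (hm ▸ hms)) ((le_max_right _ _).trans (hm ▸ hms))⟩
  have hexp : (138 * s : ℝ) ≤ 250 * Real.sqrt m := by
    rcases Nat.eq_or_lt_of_le hm1 with h | h
    · have : s = 1 := by rw [hs, ← h]; simp
      rw [this, ← h]
      norm_num
    · have h2 : (2:ℝ) ≤ m := by exact_mod_cast h
      have h3 : (1.25:ℝ) ≤ Real.sqrt m := Real.le_sqrt_of_sq_le (by norm_num; linarith)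
      have h4 : (s:ℝ) < Real.sqrt m + 1 := hs ▸ Nat.ceil_lt_add_one (Real.sqrt_nonneg _)
      linarith
  calc (ramsey G₁ G₂ : ℝ) ≤ ((2 ^ (138 * s) : ℕ) : ℝ) := by exact_mod_cast hR
    _ = (2:ℝ) ^ ((138 * s : ℕ) : ℝ) := by rw [Real.rpow_natCast]; push_cast; rfl
    _ ≤ _ := Real.rpow_le_rpow_of_exponent_le (by norm_num) (by push_cast; exact hexp)
end

section
/- If $G$ is a graph with $m$ edges and with no isolated vertices, then $R(G, G) \leq 2^{250\sqrt{m}}$. -/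
/-- A monochromatic pair: `X` is a clique of `H`, completely joined to `Y`. -/
def MPair {V : Type*} (H : SimpleGraph V) (X Y : Finset V) : Prop :=
  (∀ x ∈ X, ∀ x' ∈ X, x ≠ x' → H.Adj x x') ∧ ∀ x ∈ X, ∀ y ∈ Y, H.Adj x y

open Classical in
/-- Erdős–Szekeres type lemma for monochromatic pairs. -/
lemma mpair_exists {V : Type*} (H : SimpleGraph V) (y : ℕ) (hy : 1 ≤ y) :
    ∀ (k l : ℕ) (S : Finset V), (k + l).choose k * y ≤ S.card →
      (∃ X Y : Finset V, X ⊆ S ∧ Y ⊆ S ∧ X.card = k ∧ y ≤ Y.card ∧ MPair H X Y) ∨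
      (∃ X Y : Finset V, X ⊆ S ∧ Y ⊆ S ∧ X.card = l ∧ y ≤ Y.card ∧ MPair Hᶜ X Y) := by
  intro k
  induction k with
  | zero =>
    intro l S hS
    left
    exact ⟨∅, S, by simp, by simp, by simp, by simpa using hS, by simp [MPair]⟩
  | succ k ihk =>
    intro l
    induction l with
    | zero =>
      intro S hS
      right
      exact ⟨∅, S, by simp, by simp, by simp, by simpa using hS, by simp [MPair]⟩
    | succ l ihl =>
      intro S hS
      have hc : (k + 1 + (l + 1)).choose (k + 1)
          = (k + (l + 1)).choose k + (k + 1 + l).choose (k + 1) := by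
        have : k + 1 + (l + 1) = (k + 1 + l) + 1 := by ring
        rw [this, Nat.choose_succ_succ]
        have : k + 1 + l = k + (l + 1) := by ring
        rw [this]
      rw [hc, add_mul] at hS
      have hpos : 0 < (k + (l + 1)).choose k := Nat.choose_pos (by omega)
      have h1 : 1 ≤ (k + (l + 1)).choose k * y := Nat.mul_pos hpos hy
      have hne : S.Nonempty := by
        rw [← Finset.card_pos]; omega
      obtain ⟨v, hv⟩ := hne
      set R := (S.erase v).filter (fun w => H.Adj v w) with hR
      set B := (S.erase v).filter (fun w => ¬ H.Adj v w) with hB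
      have hRB : R.card + B.card = (S.erase v).card :=
        Finset.card_filter_add_card_filter_not _
      have hcard : (S.erase v).card = S.card - 1 := Finset.card_erase_of_mem hv
      have hRS : R ⊆ S := (Finset.filter_subset _ _).trans (Finset.erase_subset _ _)
      have hBS : B ⊆ S := (Finset.filter_subset _ _).trans (Finset.erase_subset _ _)
      have hRadj : ∀ w ∈ R, H.Adj v w := fun w hw => (Finset.mem_filter.1 hw).2
      have hBadj : ∀ w ∈ B, Hᶜ.Adj v w := fun w hw => by
        have h := Finset.mem_filter.1 hw
        rw [SimpleGraph.compl_adj]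
        exact ⟨(Finset.ne_of_mem_erase h.1).symm, h.2⟩
      have key : ∀ (K : SimpleGraph V) (T X Y : Finset V), (∀ w ∈ T, K.Adj v w) → X ⊆ T → Y ⊆ T →
          MPair K X Y → MPair K (insert v X) Y ∧ (insert v X).card = X.card + 1 := by
        intro K T X Y hT hX hY hP
        have hvX : v ∉ X := fun h => (K.irrefl (hT v (hX h)))
        refine ⟨⟨?_, ?_⟩, Finset.card_insert_of_notMem hvX⟩
        · intro x hx x' hx' hne
          rcases Finset.mem_insert.1 hx with h1 | h1
          · rcases Finset.mem_insert.1 hx' with h2 | h2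
            · exact absurd (h1.trans h2.symm) hne
            · rw [h1]; exact hT _ (hX h2)
          · rcases Finset.mem_insert.1 hx' with h2 | h2
            · rw [h2]; exact (hT _ (hX h1)).symm
            · exact hP.1 x h1 x' h2 hne
        · intro x hx y hy
          rcases Finset.mem_insert.1 hx with rfl | hx
          · exact hT _ (hY hy)
          · exact hP.2 x hx y hy
      by_cases hcase : (k + (l + 1)).choose k * y ≤ R.card
      · rcases ihk (l + 1) R hcase with ⟨X, Y, hX, hY, hXc, hYc, hP⟩ | ⟨X, Y, hX, hY, hXc, hYc, hP⟩
        · left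
          obtain ⟨h1, h2⟩ := key H R X Y hRadj hX hY hP
          exact ⟨insert v X, Y, Finset.insert_subset hv (hX.trans hRS), hY.trans hRS,
            by omega, hYc, h1⟩
        · right
          exact ⟨X, Y, hX.trans hRS, hY.trans hRS, hXc, hYc, hP⟩
      · have hcase2 : (k + 1 + l).choose (k + 1) * y ≤ B.card := by omega
        rcases ihl B hcase2 with ⟨X, Y, hX, hY, hXc, hYc, hP⟩ | ⟨X, Y, hX, hY, hXc, hYc, hP⟩
        · left
          exact ⟨X, Y, hX.trans hBS, hY.trans hBS, hXc, hYc, hP⟩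
        · right
          obtain ⟨h1, h2⟩ := key Hᶜ B X Y hBadj hX hY hP
          exact ⟨insert v X, Y, Finset.insert_subset hv (hX.trans hBS), hY.trans hBS,
            by omega, hYc, h1⟩

open Classical in
/-- Degree of `u` into `B`. -/
noncomputable def dg {V : Type*} (H : SimpleGraph V) (u : V) (B : Finset V) : ℕ :=
  (B.filter (fun w => H.Adj u w)).card

lemma dg_sum_comm {V : Type*} (H : SimpleGraph V) (A B : Finset V) :
    ∑ a ∈ A, dg H a B = ∑ b ∈ B, dg H b A := by
  classical
  unfold dg
  simp only [Finset.card_filter]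
  rw [Finset.sum_comm]
  simp only [H.adj_comm]

lemma dg_mono {V : Type*} (H : SimpleGraph V) (u : V) {A B : Finset V} (h : A ⊆ B) :
    dg H u A ≤ dg H u B := by
  classical
  exact Finset.card_le_card (Finset.filter_subset_filter _ h)

/-- Markov-type inequality: at least half of `S` is at most twice the average. -/
lemma half_good {V : Type*} [DecidableEq V] (S : Finset V) (g : V → ℕ) (c : ℕ)
    (h : ∑ y ∈ S, g y ≤ c * S.card) :
    S.card ≤ 2 * (S.filter (fun y => g y ≤ 2 * c)).card := by
  have h1 := Finset.card_filter_add_card_filter_not (s := S) (fun y => g y ≤ 2 * c)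
  set b := S.filter (fun y => ¬ g y ≤ 2 * c)
  by_contra hcon
  have h2 : b.card * (2 * c + 1) ≤ ∑ y ∈ b, g y := by
    rw [← smul_eq_mul]
    apply Finset.card_nsmul_le_sum
    intro x hx
    have := (Finset.mem_filter.1 hx).2
    omega
  have h3 : ∑ y ∈ b, g y ≤ ∑ y ∈ S, g y :=
    Finset.sum_le_sum_of_subset (Finset.filter_subset _ _)
  have h4 : S.card < 2 * b.card := by omega
  nlinarith

lemma small_subsets_card {V : Type*} [DecidableEq V] (A : Finset V) (j n : ℕ) (hA : A.card ≤ n) :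
    (A.powerset.filter (fun P => P.card ≤ j)).card ≤ ∑ i ∈ Finset.range (j + 1), n.choose i := by
  have h : A.powerset.filter (fun P => P.card ≤ j)
      ⊆ (Finset.range (j + 1)).biUnion (fun i => A.powersetCard i) := by
    intro P hP
    simp only [Finset.mem_filter, Finset.mem_powerset] at hP
    simp only [Finset.mem_biUnion, Finset.mem_range, Finset.mem_powersetCard]
    exact ⟨P.card, by omega, hP.1, rfl⟩
  calc _ ≤ _ := Finset.card_le_card h
    _ ≤ ∑ i ∈ Finset.range (j + 1), (A.powersetCard i).card := Finset.card_biUnion_le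
    _ ≤ _ := by
      apply Finset.sum_le_sum
      intro i _
      rw [Finset.card_powersetCard]
      exact Nat.choose_le_choose i hA

/-- Erdős–Szemerédi type lemma for monochromatic pairs in sparse colorings. -/
lemma sparse_mpair {V : Type*} (H : SimpleGraph V) (U : Finset V) (E t y j : ℕ)
    (hE : 16 ≤ E) (ht : 1 ≤ t) (hy : 1 ≤ y) (hj : j = 16 * t / E)
    (hsparse : E * ∑ u ∈ U, dg H u U ≤ U.card * U.card)
    (hU1 : 16 * t ≤ U.card)
    (hU2 : 8 * ((∑ i ∈ Finset.range (j + 1), (2 * t).choose i) *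
      ((j + 1 + t).choose (j + 1) * y)) ≤ U.card) :
    ∃ X Y : Finset V, t ≤ X.card ∧ y ≤ Y.card ∧ (MPair H X Y ∨ MPair Hᶜ X Y) := by
  classical
  set S := U.filter (fun u => E * dg H u U ≤ 2 * U.card) with hS
  have hScard : U.card ≤ 2 * S.card := by
    apply half_good U (fun u => E * dg H u U) U.card
    rw [← Finset.mul_sum]; exact hsparse
  have hSU : S ⊆ U := Finset.filter_subset _ _
  -- largest clique of the complement
  set F := S.powerset.filter (fun A => A.card ≤ 2 * t ∧ ∀ x ∈ A, ∀ x' ∈ A, x ≠ x' → Hᶜ.Adj x x')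
    with hF
  have hFne : F.Nonempty := ⟨∅, by simp [hF]⟩
  obtain ⟨A, hAF, hAmax⟩ := Finset.exists_max_image F Finset.card hFne
  obtain ⟨hAS, hA2t, hAcl⟩ : A ⊆ S ∧ A.card ≤ 2 * t ∧
      ∀ x ∈ A, ∀ x' ∈ A, x ≠ x' → Hᶜ.Adj x x' := by
    simpa [hF] using hAF
  have hsum : ∑ y ∈ S, E * dg H y A ≤ (4 * A.card) * S.card := by
    have h1 : ∑ y ∈ S, dg H y A ≤ ∑ a ∈ A, dg H a U := by
      rw [dg_sum_comm H S A]
      exact Finset.sum_le_sum (fun a _ => dg_mono H a hSU)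
    have h2 : ∑ a ∈ A, E * dg H a U ≤ A.card * (2 * U.card) := by
      rw [← smul_eq_mul]
      apply Finset.sum_le_card_nsmul
      intro x hx
      exact (Finset.mem_filter.1 (hAS hx)).2
    rw [← Finset.mul_sum] at h2 ⊢
    calc _ ≤ E * ∑ a ∈ A, dg H a U := Nat.mul_le_mul_left _ h1
      _ ≤ _ := h2
      _ ≤ A.card * (2 * (2 * S.card)) := by gcongr
      _ = _ := by ring
  have hgood := half_good S (fun y => E * dg H y A) (4 * A.card) hsum
  set Y0 := S.filter (fun y => E * dg H y A ≤ 2 * (4 * A.card)) with hY0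
  have hY1 : Y0.card ≤ (Y0 \ A).card + A.card := by
    have := Finset.le_card_sdiff A Y0
    omega
  set Y1 := Y0 \ A with hY1d
  have hYU : U.card ≤ 8 * Y1.card := by omega
  set PP := A.powerset.filter (fun P => P.card ≤ j) with hPP
  have hmaps : ∀ y ∈ Y1, A.filter (fun a => H.Adj y a) ∈ PP := by
    intro y hy
    rw [hPP, Finset.mem_filter]
    refine ⟨Finset.mem_powerset.2 (Finset.filter_subset _ _), ?_⟩
    have h1 : E * dg H y A ≤ 2 * (4 * A.card) :=
      (Finset.mem_filter.1 (Finset.mem_sdiff.1 hy).1).2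
    rw [hj, Nat.le_div_iff_mul_le (by omega), mul_comm]
    change E * dg H y A ≤ _
    omega
  have hPPcard := small_subsets_card A j (2 * t) hA2t
  rw [← hPP] at hPPcard
  set K1 := ∑ i ∈ Finset.range (j + 1), (2 * t).choose i with hK1
  set K2 := (j + 1 + t).choose (j + 1) with hK2
  have hPPne : PP.Nonempty := ⟨∅, by simp [hPP]⟩
  obtain ⟨P, hPPP, hPcard⟩ : ∃ P ∈ PP, K2 * y ≤
      (Y1.filter (fun y => A.filter (fun a => H.Adj y a) = P)).card := by
    apply Finset.exists_le_card_fiber_of_mul_le_card_of_maps_to hmaps hPPne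
    calc PP.card * (K2 * y) ≤ K1 * (K2 * y) := Nat.mul_le_mul_right _ hPPcard
      _ ≤ _ := by omega
  set Fb := Y1.filter (fun y => A.filter (fun a => H.Adj y a) = P) with hFb
  obtain ⟨hPA, hPj⟩ : P ⊆ A ∧ P.card ≤ j := by simpa [hPP] using hPPP
  have hjoin : ∀ x ∈ A \ P, ∀ y ∈ Fb, Hᶜ.Adj x y := by
    intro x hx y hy
    obtain ⟨hxA, hxP⟩ := Finset.mem_sdiff.1 hx
    obtain ⟨hy1, hy2⟩ := Finset.mem_filter.1 hy
    have hyA : y ∉ A := (Finset.mem_sdiff.1 hy1).2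
    rw [SimpleGraph.compl_adj]
    refine ⟨fun h => hyA (h ▸ hxA), fun h => hxP ?_⟩
    rw [← hy2, Finset.mem_filter]
    exact ⟨hxA, h.symm⟩
  have hPsd : (A \ P).card = A.card - P.card := Finset.card_sdiff_of_subset hPA
  have hK2pos : 1 ≤ K2 := Nat.choose_pos (by omega)
  have hjt : j ≤ t := by
    rw [hj]; exact Nat.div_le_of_le_mul (Nat.mul_le_mul_right t hE)
  by_cases hcase : A.card = 2 * t
  · refine ⟨A \ P, Fb, by omega, ?_, Or.inr ⟨?_, hjoin⟩⟩
    · exact le_trans (Nat.le_mul_of_pos_left y hK2pos) hPcard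
    · intro x hx x' hx' hne
      exact hAcl x (Finset.mem_sdiff.1 hx).1 x' (Finset.mem_sdiff.1 hx').1 hne
  · have hch : (t + (P.card + 1)).choose t * y ≤ Fb.card := by
      refine le_trans ?_ hPcard
      apply Nat.mul_le_mul_right
      calc (t + (P.card + 1)).choose t ≤ (t + (j + 1)).choose t :=
            Nat.choose_le_choose _ (by omega)
        _ = K2 := by
          rw [hK2, add_comm (j + 1) t]
          exact Nat.choose_symm_of_eq_add rfl
    rcases mpair_exists H y hy t (P.card + 1) Fb hch with
      ⟨X, Y, hX, hY, hXc, hYc, hP⟩ | ⟨X, Y, hX, hY, hXc, hYc, hP⟩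
    · exact ⟨X, Y, hXc.ge, hYc, Or.inl hP⟩
    · exfalso
      have hFbS : Fb ⊆ S := ((Finset.filter_subset _ _).trans Finset.sdiff_subset).trans
        (Finset.filter_subset _ _)
      have hdisj : Disjoint (A \ P) X := by
        rw [Finset.disjoint_left]
        intro x hx hx'
        exact Hᶜ.irrefl (hjoin x hx x (hX hx'))
      have hcard : ((A \ P) ∪ X).card = A.card + 1 := by
        rw [Finset.card_union_of_disjoint hdisj, hPsd, hXc]
        have := Finset.card_le_card hPA
        omega
      have hmem : (A \ P) ∪ X ∈ F := by
        simp only [hF, Finset.mem_filter, Finset.mem_powerset]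
        refine ⟨?_, ?_, ?_⟩
        · exact Finset.union_subset (Finset.sdiff_subset.trans hAS) (hX.trans hFbS)
        · omega
        intro x hx x' hx' hne
        rcases Finset.mem_union.1 hx with h1 | h1
        · rcases Finset.mem_union.1 hx' with h2 | h2
          · exact hAcl x (Finset.mem_sdiff.1 h1).1 x' (Finset.mem_sdiff.1 h2).1 hne
          · exact hjoin x h1 x' (hX h2)
        · rcases Finset.mem_union.1 hx' with h2 | h2
          · exact (hjoin x' h2 x (hX h1)).symm
          · exact hP.1 x h1 x' h2 hne
      have := hAmax _ hmem
      omega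

/-- Greedy embedding of a bounded degree graph into a bi-dense graph. -/
lemma greedy_embed {α V : Type*} [Fintype α] (G : SimpleGraph α) (H : SimpleGraph V)
    (D0 : Finset α) (Y : Finset V) (E Δ : ℕ) (hE : 1 ≤ E) (hΔ : 1 ≤ Δ)
    (hdeg : ∀ v ∈ D0, dg G v Finset.univ ≤ Δ)
    (hN : 2 * Fintype.card α * E ^ Δ ≤ Y.card)
    (hdense : ∀ A B : Finset V, A ⊆ Y → B ⊆ Y → Y.card ≤ 2 * Δ * E ^ Δ * A.card →
      Y.card ≤ E ^ Δ * B.card → ∃ a ∈ A, B.card ≤ E * dg H a B) :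
    ∃ f : α → V, (∀ v ∈ D0, f v ∈ Y) ∧ Set.InjOn f D0 ∧
      ∀ u ∈ D0, ∀ v ∈ D0, G.Adj u v → H.Adj (f u) (f v) := by
  classical
  rcases isEmpty_or_nonempty α with hα | hα
  · exact ⟨fun a => isEmptyElim a, fun v => isEmptyElim v, fun v => isEmptyElim v,
      fun v => isEmptyElim v⟩
  have hn : 1 ≤ Fintype.card α := Fintype.card_pos
  have hEp : 1 ≤ E ^ Δ := Nat.one_le_pow _ _ hE
  have hYne : Y.Nonempty := by
    rw [← Finset.card_pos]
    nlinarith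
  obtain ⟨y0, hy0⟩ := hYne
  have main : ∀ D : Finset α, D ⊆ D0 → ∃ (f : α → V) (C : α → Finset V),
      (∀ v ∈ D, f v ∈ Y) ∧ Set.InjOn f D ∧
      (∀ u ∈ D, ∀ v ∈ D, G.Adj u v → H.Adj (f u) (f v)) ∧
      (∀ u, C u ⊆ Y) ∧ (∀ u, Y.card ≤ E ^ (dg G u D) * (C u).card) ∧
      (∀ u ∈ D0, u ∉ D → ∀ v ∈ D, G.Adj u v → ∀ x ∈ C u, H.Adj (f v) x) := by
    intro D
    induction D using Finset.induction_on with
    | empty =>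
      intro _
      exact ⟨fun _ => y0, fun _ => Y, by simp, by simp, by simp, by simp, by simp [dg], by simp⟩
    | insert w D hwD ih =>
      intro hsub
      obtain ⟨f, C, hfY, hinj, hadj, hCY, hCcard, hCadj⟩ :=
        ih ((Finset.subset_insert _ _).trans hsub)
      have hw0 : w ∈ D0 := hsub (Finset.mem_insert_self _ _)
      have hCbig : ∀ u ∈ D0, Y.card ≤ E ^ Δ * (C u).card := by
        intro u hu
        refine (hCcard u).trans ?_
        apply Nat.mul_le_mul_right
        apply Nat.pow_le_pow_right hE
        exact (dg_mono G u (Finset.subset_univ _)).trans (hdeg u hu)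
      set bad : α → Finset V :=
        fun u => (C w).filter (fun x => E * dg H x (C u) < (C u).card) with hbad
      have hbadcard : ∀ u ∈ D0, 2 * Δ * (bad u).card ≤ (C w).card := by
        intro u hu
        by_contra hcon
        push Not at hcon
        have h1 : Y.card ≤ 2 * Δ * E ^ Δ * (bad u).card := by
          calc Y.card ≤ E ^ Δ * (C w).card := hCbig w hw0
            _ ≤ E ^ Δ * (2 * Δ * (bad u).card) := Nat.mul_le_mul_left _ hcon.le
            _ = _ := by ring
        obtain ⟨a, ha, hab⟩ := hdense (bad u) (C u) ((Finset.filter_subset _ _).trans (hCY w))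
          (hCY u) h1 (hCbig u hu)
        have := (Finset.mem_filter.1 ha).2
        omega
      set NW := D0.filter (fun u => G.Adj w u) with hNW
      have hNWcard : NW.card ≤ Δ := by
        refine le_trans ?_ (hdeg w hw0)
        exact dg_mono G w (Finset.subset_univ D0)
      have hbadU : 2 * (NW.biUnion bad).card ≤ (C w).card := by
        have h1 : (NW.biUnion bad).card ≤ ∑ u ∈ NW, (bad u).card := Finset.card_biUnion_le
        have h2 : ∑ u ∈ NW, 2 * Δ * (bad u).card ≤ NW.card * (C w).card := by
          rw [← smul_eq_mul]
          apply Finset.sum_le_card_nsmul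
          intro u hu
          exact hbadcard u (Finset.mem_filter.1 hu).1
        rw [← Finset.mul_sum] at h2
        have h3 : Δ * (2 * (NW.biUnion bad).card) ≤ Δ * (C w).card := by
          calc Δ * (2 * (NW.biUnion bad).card) = 2 * Δ * (NW.biUnion bad).card := by ring
            _ ≤ 2 * Δ * ∑ u ∈ NW, (bad u).card := Nat.mul_le_mul_left _ h1
            _ ≤ _ := h2
            _ ≤ _ := Nat.mul_le_mul_right _ hNWcard
        exact Nat.le_of_mul_le_mul_left h3 hΔ
      have hCw : 2 * Fintype.card α ≤ (C w).card := by
        have h1 := hN.trans (hCbig w hw0)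
        have h2 : E ^ Δ * (2 * Fintype.card α) ≤ E ^ Δ * (C w).card := by
          calc _ = 2 * Fintype.card α * E ^ Δ := by ring
            _ ≤ _ := h1
        exact Nat.le_of_mul_le_mul_left h2 hEp
      have hDcard : (D.image f).card < Fintype.card α := by
        have h1 : (insert w D).card ≤ Fintype.card α := Finset.card_le_univ _
        rw [Finset.card_insert_of_notMem hwD] at h1
        have := Finset.card_image_le (s := D) (f := f)
        omega
      obtain ⟨x, hxC, hxn⟩ : ∃ x ∈ C w, x ∉ NW.biUnion bad ∪ D.image f := by
        apply Finset.exists_mem_notMem_of_card_lt_card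
        have := Finset.card_union_le (NW.biUnion bad) (D.image f)
        omega
      rw [Finset.mem_union, not_or] at hxn
      obtain ⟨hxbad, hxim⟩ := hxn
      have hgood : ∀ u ∈ D0, G.Adj w u → (C u).card ≤ E * dg H x (C u) := by
        intro u hu hwu
        by_contra hcon
        apply hxbad
        rw [Finset.mem_biUnion]
        exact ⟨u, Finset.mem_filter.2 ⟨hu, hwu⟩, Finset.mem_filter.2 ⟨hxC, by omega⟩⟩
      have hfold : ∀ v ∈ D, Function.update f w x v = f v := by
        intro v hv
        have hvw : v ≠ w := by
          rintro rfl
          exact hwD hv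
        exact Function.update_of_ne hvw _ _
      have hfw : Function.update f w x w = x := Function.update_self _ _ _
      refine ⟨Function.update f w x,
        fun u => if G.Adj w u ∧ u ∈ D0 then (C u).filter (fun z => H.Adj x z) else
          if u ∈ D0 then C u else Y, ?_, ?_, ?_, ?_, ?_, ?_⟩
      · intro v hv
        rcases Finset.mem_insert.1 hv with rfl | hv
        · rw [hfw]; exact hCY _ hxC
        · rw [hfold v hv]; exact hfY v hv
      · intro u hu v hv huv
        rw [Finset.mem_coe, Finset.mem_insert] at hu hv
        rcases hu with h1 | h1
        · rcases hv with h2 | h2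
          · rw [h1, h2]
          · rw [h1, hfw, hfold v h2] at huv
            exact absurd (Finset.mem_image.2 ⟨v, h2, huv.symm⟩) hxim
        · rcases hv with h2 | h2
          · rw [h2, hfw, hfold u h1] at huv
            exact absurd (Finset.mem_image.2 ⟨u, h1, huv⟩) hxim
          · rw [hfold u h1, hfold v h2] at huv
            exact hinj h1 h2 huv
      · intro u hu v hv huv
        rcases Finset.mem_insert.1 hu with h1 | h1
        · rcases Finset.mem_insert.1 hv with h2 | h2
          · rw [h1, h2] at huv
            exact absurd huv (G.irrefl)
          · rw [h1] at huv ⊢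
            rw [hfw, hfold v h2]
            exact (hCadj w hw0 hwD v h2 huv x hxC).symm
        · rcases Finset.mem_insert.1 hv with h2 | h2
          · rw [h2] at huv ⊢
            rw [hfw, hfold u h1]
            exact (hCadj w hw0 hwD u h1 huv.symm x hxC)
          · rw [hfold u h1, hfold v h2]
            exact hadj u h1 v h2 huv
      · intro u
        dsimp only
        split_ifs
        · exact (Finset.filter_subset _ _).trans (hCY u)
        · exact hCY u
        · exact subset_rfl
      · intro u
        dsimp only
        split_ifs with h1 h2
        · have hd : dg G u (insert w D) = dg G u D + 1 := by
            unfold dg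
            rw [Finset.filter_insert, if_pos h1.1.symm, Finset.card_insert_of_notMem]
            simp [hwD]
          rw [hd, pow_succ, mul_assoc]
          refine (hCcard u).trans ?_
          apply Nat.mul_le_mul_left
          exact hgood u h1.2 h1.1
        · refine (hCcard u).trans ?_
          apply Nat.mul_le_mul_right
          exact Nat.pow_le_pow_right hE (dg_mono G u (Finset.subset_insert _ _))
        · exact Nat.le_mul_of_pos_left _ (Nat.pow_pos hE)
      · intro u hu huD v hv huv z hz
        dsimp only at hz
        rw [Finset.mem_insert, not_or] at huD
        rcases Finset.mem_insert.1 hv with h2 | h2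
        · rw [h2] at huv ⊢
          rw [hfw]
          rw [if_pos ⟨huv.symm, hu⟩] at hz
          exact (Finset.mem_filter.1 hz).2
        · rw [hfold v h2]
          apply hCadj u hu huD.2 v h2 huv
          split_ifs at hz
          · exact (Finset.mem_filter.1 hz).1
          · exact hz
  obtain ⟨f, C, h1, h2, h3, -⟩ := main D0 subset_rfl
  exact ⟨f, h1, h2, h3⟩

/-- If a bounded degree graph does not embed, there is a sparse pair of disjoint sets. -/
lemma sparse_pair {α V : Type*} [Fintype α] [DecidableEq V] (G : SimpleGraph α) (H : SimpleGraph V)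
    (D0 : Finset α) (Y : Finset V) (E Δ z : ℕ) (hE : 1 ≤ E) (hΔ : 1 ≤ Δ)
    (hdeg : ∀ v ∈ D0, dg G v Finset.univ ≤ Δ)
    (hz : Fintype.card α ≤ z)
    (hN : 4 * Δ * E ^ Δ * z ≤ Y.card)
    (hno : ¬ ∃ f : α → V, (∀ v ∈ D0, f v ∈ Y) ∧ Set.InjOn f D0 ∧
      ∀ u ∈ D0, ∀ v ∈ D0, G.Adj u v → H.Adj (f u) (f v)) :
    ∃ A B : Finset V, A ⊆ Y ∧ B ⊆ Y ∧ Disjoint A B ∧ z ≤ A.card ∧ 2 * z ≤ B.card ∧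
      ∀ a ∈ A, E * dg H a B ≤ 2 * B.card := by
  have hEp : 1 ≤ E ^ Δ := Nat.one_le_pow _ _ hE
  by_contra hcon
  apply hno
  apply greedy_embed G H D0 Y E Δ hE hΔ hdeg
  · refine le_trans ?_ hN
    calc 2 * Fintype.card α * E ^ Δ ≤ (4 * Δ) * z * E ^ Δ := by gcongr; omega
      _ = _ := by ring
  · intro A B hA hB hAc hBc
    by_contra hcon2
    push Not at hcon2
    apply hcon
    have hA2 : 2 * z ≤ A.card := by
      have h : 2 * Δ * E ^ Δ * (2 * z) ≤ 2 * Δ * E ^ Δ * A.card := by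
        refine le_trans (le_trans (le_of_eq ?_) hN) hAc
        ring
      exact Nat.le_of_mul_le_mul_left h (by positivity)
    have hB2 : 4 * z ≤ B.card := by
      have h : E ^ Δ * (4 * z) ≤ E ^ Δ * B.card := by
        refine le_trans (le_trans ?_ hN) hBc
        calc E ^ Δ * (4 * z) = 4 * 1 * E ^ Δ * z := by ring
          _ ≤ _ := by gcongr
      exact Nat.le_of_mul_le_mul_left h hEp
    obtain ⟨A', hA', hA'c⟩ := Finset.exists_subset_card_eq (show z ≤ A.card by omega)
    have hBs := Finset.le_card_sdiff A' B
    refine ⟨A', B \ A', hA'.trans hA, Finset.sdiff_subset.trans hB, Finset.disjoint_sdiff,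
      hA'c.ge, by omega, ?_⟩
    intro a ha
    have h1 := hcon2 a (hA' ha)
    have h2 : E * dg H a (B \ A') ≤ E * dg H a B :=
      Nat.mul_le_mul_left _ (dg_mono H a Finset.sdiff_subset)
    omega

/-- If a bounded degree graph does not embed, there is a large sparse set. -/
lemma sparse_set {α V : Type*} [Fintype α] (G : SimpleGraph α) (H : SimpleGraph V)
    (D0 : Finset α) (E Δ s : ℕ) (hE : 1 ≤ E) (hΔ : 1 ≤ Δ)
    (hdeg : ∀ v ∈ D0, dg G v Finset.univ ≤ Δ)
    (hs : Fintype.card α ≤ s) : ∀ (h : ℕ) (Y : Finset V),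
    (4 * Δ * E ^ Δ) ^ h * s ≤ Y.card →
    (¬ ∃ f : α → V, (∀ v ∈ D0, f v ∈ Y) ∧ Set.InjOn f D0 ∧
      ∀ u ∈ D0, ∀ v ∈ D0, G.Adj u v → H.Adj (f u) (f v)) →
    ∃ U : Finset V, U ⊆ Y ∧ U.card = 2 ^ h * s ∧
      E * ∑ u ∈ U, dg H u U ≤ (2 ^ h * E + 4 * 4 ^ h) * s ^ 2 := by
  classical
  intro h
  induction h with
  | zero =>
    intro Y hY _
    obtain ⟨U, hU, hUc⟩ := Finset.exists_subset_card_eq (show s ≤ Y.card by simpa using hY)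
    refine ⟨U, hU, by simpa using hUc, ?_⟩
    have h1 : ∑ u ∈ U, dg H u U ≤ U.card * U.card := by
      rw [← smul_eq_mul]
      apply Finset.sum_le_card_nsmul
      intro x _
      exact Finset.card_le_card (Finset.filter_subset _ _)
    rw [hUc] at h1
    nlinarith
  | succ h ih =>
    intro Y hY hno
    set K := 4 * Δ * E ^ Δ with hK
    have hK1 : 1 ≤ K := by
      have hEp : 1 ≤ E ^ Δ := Nat.one_le_pow _ _ hE
      rw [hK]
      exact Nat.mul_pos (by omega) hEp
    have hno' : ∀ Y' ⊆ Y, ¬ ∃ f : α → V, (∀ v ∈ D0, f v ∈ Y') ∧ Set.InjOn f D0 ∧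
        ∀ u ∈ D0, ∀ v ∈ D0, G.Adj u v → H.Adj (f u) (f v) := by
      rintro Y' hY' ⟨f, h1, h2⟩
      exact hno ⟨f, fun v hv => hY' (h1 v hv), h2⟩
    obtain ⟨A, B, hAY, hBY, hAB, hAc, hBc, hdAB⟩ := sparse_pair G H D0 Y E Δ (K ^ h * s) hE hΔ hdeg
      (hs.trans (Nat.le_mul_of_pos_left _ (Nat.pow_pos hK1)))
      (by rw [← hK]; refine le_trans (le_of_eq ?_) hY; ring) hno
    obtain ⟨A0, hA0, hA0c, hA0d⟩ := ih A hAc (hno' A hAY)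
    set u := 2 ^ h * s with hu
    have hsum : ∑ b ∈ B, E * dg H b A0 ≤ (2 * u) * B.card := by
      rw [← Finset.mul_sum, ← dg_sum_comm H A0 B, Finset.mul_sum]
      calc ∑ a ∈ A0, E * dg H a B ≤ A0.card * (2 * B.card) := by
            rw [← smul_eq_mul]
            apply Finset.sum_le_card_nsmul
            intro a ha
            exact hdAB a (hA0 ha)
        _ = _ := by rw [hA0c]; ring
    have hhalf := half_good B (fun b => E * dg H b A0) (2 * u) hsum
    set B1 := B.filter (fun b => E * dg H b A0 ≤ 2 * (2 * u)) with hB1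
    have hB1B : B1 ⊆ B := Finset.filter_subset _ _
    obtain ⟨B0, hB0, hB0c, hB0d⟩ := ih B1 (by omega) (hno' B1 (hB1B.trans hBY))
    have hdisj : Disjoint A0 B0 := Finset.disjoint_of_subset_left hA0
      (Finset.disjoint_of_subset_right (hB0.trans hB1B) hAB)
    refine ⟨A0 ∪ B0, Finset.union_subset (hA0.trans hAY) ((hB0.trans hB1B).trans hBY), ?_, ?_⟩
    · rw [Finset.card_union_of_disjoint hdisj, hA0c, hB0c, hu]; ring
    · have hcross : E * ∑ b ∈ B0, dg H b A0 ≤ u * (4 * u) := by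
        rw [Finset.mul_sum]
        calc ∑ b ∈ B0, E * dg H b A0 ≤ B0.card * (4 * u) := by
              rw [← smul_eq_mul]
              apply Finset.sum_le_card_nsmul
              intro b hb
              have := (Finset.mem_filter.1 (hB0 hb)).2
              omega
          _ = _ := by rw [hB0c]
      have hsplit : ∀ v, dg H v (A0 ∪ B0) ≤ dg H v A0 + dg H v B0 := by
        intro v
        unfold dg
        rw [Finset.filter_union]
        exact Finset.card_union_le _ _
      have h1 : ∑ v ∈ A0 ∪ B0, dg H v (A0 ∪ B0) ≤
          (∑ v ∈ A0, dg H v A0 + ∑ v ∈ B0, dg H v B0) + 2 * ∑ b ∈ B0, dg H b A0 := by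
        refine (Finset.sum_le_sum (fun v _ => hsplit v)).trans ?_
        rw [Finset.sum_union hdisj, Finset.sum_add_distrib, Finset.sum_add_distrib,
          dg_sum_comm H A0 B0]
        omega
      calc E * ∑ v ∈ A0 ∪ B0, dg H v (A0 ∪ B0)
          ≤ E * ((∑ v ∈ A0, dg H v A0 + ∑ v ∈ B0, dg H v B0) + 2 * ∑ b ∈ B0, dg H b A0) :=
            Nat.mul_le_mul_left _ h1
        _ = E * ∑ v ∈ A0, dg H v A0 + E * ∑ v ∈ B0, dg H v B0
            + 2 * (E * ∑ b ∈ B0, dg H b A0) := by ring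
        _ ≤ (2 ^ h * E + 4 * 4 ^ h) * s ^ 2 + (2 ^ h * E + 4 * 4 ^ h) * s ^ 2
            + 2 * (u * (4 * u)) := by gcongr
        _ = _ := by
          have : (4 : ℕ) ^ h = 2 ^ h * 2 ^ h := by rw [← mul_pow]; norm_num
          rw [hu, pow_succ 2 h, pow_succ 4 h, this]; ring

/-- Embedding of the whole graph: high degree vertices in `X`, the rest in `Y`. -/
lemma copy_of_mpair {α V : Type*} [Fintype α] [DecidableEq α] (G : SimpleGraph α) (H : SimpleGraph V)
    (X Y : Finset V) (hP : MPair H X Y) (D0 : Finset α)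
    (hcard : (Finset.univ.filter (fun v => v ∉ D0)).card ≤ X.card)
    (hf : ∃ f : α → V, (∀ v ∈ D0, f v ∈ Y) ∧ Set.InjOn f D0 ∧
      ∀ u ∈ D0, ∀ v ∈ D0, G.Adj u v → H.Adj (f u) (f v)) : IsCopyIn G H := by
  classical
  obtain ⟨f, hfY, hinj, hadj⟩ := hf
  set W := Finset.univ.filter (fun v => v ∉ D0) with hW
  have hmem : ∀ v, v ∉ D0 → v ∈ W := fun v hv => by simp [hW, hv]
  obtain ⟨X', hX', hX'c⟩ := Finset.exists_subset_card_eq hcard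
  have e : W ≃ X' := Finset.equivOfCardEq hX'c.symm
  set g : α → V := fun v => if h : v ∈ D0 then f v else (e ⟨v, hmem v h⟩ : V) with hg
  have hg1 : ∀ v, v ∈ D0 → g v = f v := fun v hv => by simp [hg, hv]
  have hg2 : ∀ v (h : v ∉ D0), g v = (e ⟨v, hmem v h⟩ : V) := fun v hv => by simp [hg, hv]
  have hgY : ∀ v, v ∈ D0 → g v ∈ Y := fun v hv => by rw [hg1 v hv]; exact hfY v hv
  have hgX : ∀ v, v ∉ D0 → g v ∈ X := fun v hv => by
    rw [hg2 v hv]; exact hX' (e ⟨v, hmem v hv⟩).2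
  have hginj : Function.Injective g := by
    intro u v huv
    by_cases hu : u ∈ D0
    · by_cases hv : v ∈ D0
      · rw [hg1 u hu, hg1 v hv] at huv
        exact hinj hu hv huv
      · exact absurd (hP.2 _ (hgX v hv) _ (hgY u hu)) (by rw [huv]; exact H.irrefl)
    · by_cases hv : v ∈ D0
      · exact absurd (hP.2 _ (hgX u hu) _ (hgY v hv)) (by rw [huv]; exact H.irrefl)
      · rw [hg2 u hu, hg2 v hv] at huv
        have := e.injective (Subtype.ext huv)
        simpa using this
  refine ⟨⟨g, hginj⟩, ?_⟩
  intro a b hab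
  change H.Adj (g a) (g b)
  by_cases ha : a ∈ D0
  · by_cases hb : b ∈ D0
    · rw [hg1 a ha, hg1 b hb]
      exact hadj a ha b hb hab
    · exact (hP.2 _ (hgX b hb) _ (hgY a ha)).symm
  · by_cases hb : b ∈ D0
    · exact hP.2 _ (hgX a ha) _ (hgY b hb)
    · exact hP.1 _ (hgX a ha) _ (hgX b hb) (hginj.ne hab.ne)

/-- One step of the iteration. -/
lemma step {α V : Type*} [Fintype α] (G : SimpleGraph α) (H : SimpleGraph V)
    (X Y : Finset V) (hP : MPair H X Y) (m t t' y' d Δ j : ℕ)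
    (hsum : ∑ v : α, dg G v Finset.univ = 2 * m)
    (hno : ¬ IsCopyIn G H) (ht : 1 ≤ t) (htm : t ≤ 2 * m) (htX : t ≤ X.card)
    (hΔ : Δ = 2 * m / t) (hd : 1 ≤ d) (ht' : 1 ≤ t') (ht'y : t' ≤ y')
    (hny : Fintype.card α ≤ y') (hj : j = 16 * t' / (8 * 2 ^ d))
    (hY : (4 * Δ * (64 * 2 ^ d) ^ Δ) ^ (d + 4) *
      ((∑ i ∈ Finset.range (j + 1), (2 * t').choose i) *
      ((j + 1 + t').choose (j + 1) * y')) ≤ Y.card) :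
    ∃ X' Y' : Finset V, t' ≤ X'.card ∧ y' ≤ Y'.card ∧ (MPair H X' Y' ∨ MPair Hᶜ X' Y') := by
  classical
  have hΔ1 : 1 ≤ Δ := by rw [hΔ]; exact Nat.div_pos htm ht
  set D0 : Finset α := Finset.univ.filter (fun v => dg G v Finset.univ ≤ Δ) with hD0
  have hdeg : ∀ v ∈ D0, dg G v Finset.univ ≤ Δ := fun v hv => (Finset.mem_filter.1 hv).2
  set W := Finset.univ.filter (fun v => v ∉ D0) with hW
  have hWc : W.card ≤ X.card := by
    refine le_trans ?_ htX
    have h1 : W.card * (Δ + 1) ≤ ∑ v ∈ W, dg G v Finset.univ := by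
      rw [← smul_eq_mul]
      apply Finset.card_nsmul_le_sum
      intro v hv
      have h2 := (Finset.mem_filter.1 hv).2
      rw [hD0, Finset.mem_filter] at h2
      simp only [Finset.mem_univ, true_and] at h2
      omega
    have h2 : ∑ v ∈ W, dg G v Finset.univ ≤ 2 * m := by
      rw [← hsum]
      exact Finset.sum_le_sum_of_subset (Finset.subset_univ _)
    have h3 : 2 * m < t * (Δ + 1) := by
      rw [hΔ]; exact Nat.lt_mul_div_succ _ ht
    by_contra hcon
    push Not at hcon
    nlinarith
  have hno2 : ¬ ∃ f : α → V, (∀ v ∈ D0, f v ∈ Y) ∧ Set.InjOn f D0 ∧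
      ∀ u ∈ D0, ∀ v ∈ D0, G.Adj u v → H.Adj (f u) (f v) :=
    fun hf => hno (copy_of_mpair G H X Y hP D0 hWc hf)
  set K1 := ∑ i ∈ Finset.range (j + 1), (2 * t').choose i with hK1
  set K2 := (j + 1 + t').choose (j + 1) with hK2
  have hK2pos : 1 ≤ K2 := Nat.choose_pos (by omega)
  have hK1pos : 1 ≤ K1 := by
    rw [hK1, Finset.sum_range_succ']
    simp
  set s := K1 * (K2 * y') with hs
  have hys : y' ≤ s := by
    rw [hs]
    exact (Nat.le_mul_of_pos_left _ hK2pos).trans (Nat.le_mul_of_pos_left _ hK1pos)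
  obtain ⟨U, hUY, hUc, hUd⟩ := sparse_set G H D0 (64 * 2 ^ d) Δ s
    (Nat.mul_pos (by norm_num) (Nat.pow_pos (by norm_num))) hΔ1 hdeg (hny.trans hys) (d + 4) Y hY hno2
  have h2d : 2 ≤ 2 ^ d := by
    calc 2 = 2 ^ 1 := by norm_num
      _ ≤ 2 ^ d := Nat.pow_le_pow_right (by norm_num) hd
  have hUc2 : U.card = 16 * 2 ^ d * s := by rw [hUc, pow_add]; ring
  have hU16 : 16 * s ≤ U.card := by rw [hUc2]; nlinarith
  apply sparse_mpair H U (8 * 2 ^ d) t' y' j (by omega) ht' (ht'.trans ht'y) hj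
  · have h4 : (4 : ℕ) ^ d = 2 ^ d * 2 ^ d := by rw [← mul_pow]; norm_num
    rw [pow_add, pow_add, h4] at hUd
    rw [hUc2]
    nlinarith
  · omega
  · change 8 * s ≤ _
    omega

lemma sum_choose_le (D : ℝ) (hD : 1 ≤ D) (n j : ℕ) (hj : j ≤ n) :
    ((∑ i ∈ Finset.range (j + 1), n.choose i : ℕ) : ℝ) ≤ (1 + 1 / D) ^ n * D ^ j := by
  have hD0 : 0 < D := by linarith
  have h1 : (1 + 1 / D) ^ n = ∑ i ∈ Finset.range (n + 1), (1 / D) ^ i * (n.choose i : ℝ) := by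
    rw [add_comm, add_pow]
    simp
  rw [h1, Finset.sum_mul]
  push_cast
  calc ∑ i ∈ Finset.range (j + 1), (n.choose i : ℝ)
      ≤ ∑ i ∈ Finset.range (j + 1), (1 / D) ^ i * (n.choose i : ℝ) * D ^ j := by
        apply Finset.sum_le_sum
        intro i hi
        have hij : i ≤ j := by simpa [Nat.lt_succ_iff] using hi
        have h2 : 1 ≤ (1 / D) ^ i * D ^ j := by
          rw [one_div, inv_pow, ← div_eq_inv_mul, one_le_div (by positivity)]
          exact pow_le_pow_right₀ hD hij
        have h3 : (0 : ℝ) ≤ n.choose i := by positivity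
        calc (n.choose i : ℝ) = 1 * n.choose i := by ring
          _ ≤ ((1 / D) ^ i * D ^ j) * n.choose i := by gcongr
          _ = _ := by ring
    _ ≤ _ := by
        apply Finset.sum_le_sum_of_subset_of_nonneg
        · intro i hi
          simp only [Finset.mem_range] at hi ⊢
          omega
        · intro i _ _
          positivity

lemma choose_le_aux (D : ℝ) (hD : 1 ≤ D) (n j : ℕ) (hj : j ≤ n) :
    ((n.choose j : ℕ) : ℝ) ≤ (1 + 1 / D) ^ n * D ^ j := by
  refine le_trans ?_ (sum_choose_le D hD n j hj)
  norm_cast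
  exact Finset.single_le_sum (f := fun i => n.choose i) (fun i _ => Nat.zero_le _)
    (Finset.mem_range.2 (Nat.lt_succ_self j))

lemma one_add_pow_le (D : ℝ) (hD : 1 ≤ D) (n : ℕ) :
    (1 + 1 / D) ^ n ≤ (2 : ℝ) ^ (2 * n / D) := by
  have hD0 : 0 < D := by linarith
  have h1 : 1 + 1 / D ≤ (2 : ℝ) ^ (2 / D) := by
    rw [Real.rpow_def_of_pos (by norm_num)]
    have h2 := Real.add_one_le_exp (Real.log 2 * (2 / D))
    have h3 := Real.log_two_gt_d9
    have h4 : 1 / D ≤ Real.log 2 * (2 / D) := by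
      rw [mul_div_assoc', div_le_div_iff_of_pos_right hD0]
      linarith
    linarith
  calc (1 + 1 / D) ^ n ≤ ((2 : ℝ) ^ (2 / D)) ^ n := by gcongr
    _ = _ := by
      rw [← Real.rpow_natCast, ← Real.rpow_mul (by norm_num)]
      congr 1
      ring

lemma pow_two_rpow (d j : ℕ) : (((2 : ℝ) ^ d) ^ j) = (2 : ℝ) ^ ((d : ℝ) * j) := by
  rw [← pow_mul, ← Real.rpow_natCast]
  push_cast
  rfl

lemma numeric_bc (d t' j : ℕ) (ht' : 1 ≤ t') (hd : 1 ≤ d) (hj : j = 16 * t' / (8 * 2 ^ d)) :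
    (((∑ i ∈ Finset.range (j + 1), (2 * t').choose i) * (j + 1 + t').choose (j + 1) : ℕ) : ℝ)
      ≤ (2 : ℝ) ^ ((10 + 4 * d) * (t' / 2 ^ d : ℝ) + d) := by
  have hD : (1 : ℝ) ≤ 2 ^ d := one_le_pow₀ (by norm_num)
  have hD0 : (0 : ℝ) < 2 ^ d := by linarith
  have h2d : 2 ≤ 2 ^ d := by
    calc 2 = 2 ^ 1 := by norm_num
      _ ≤ 2 ^ d := Nat.pow_le_pow_right (by norm_num) hd
  have hjt : j ≤ t' := by
    rw [hj]; exact Nat.div_le_of_le_mul (Nat.mul_le_mul_right t' (by omega))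
  have hjr : (j : ℝ) ≤ 2 * (t' / 2 ^ d : ℝ) := by
    have h1 : j * (8 * 2 ^ d) ≤ 16 * t' := by rw [hj]; exact Nat.div_mul_le_self _ _
    have h2 : (j : ℝ) * (8 * 2 ^ d) ≤ 16 * t' := by exact_mod_cast h1
    rw [mul_div_assoc', le_div_iff₀ hD0]
    linarith
  set τ : ℝ := t' / 2 ^ d with hτ
  have hτ0 : 0 ≤ τ := by positivity
  have hA := (sum_choose_le (2 ^ d) hD (2 * t') j (by omega)).trans
    (mul_le_mul_of_nonneg_right (one_add_pow_le (2 ^ d) hD (2 * t')) (by positivity))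
  have hB := (choose_le_aux (2 ^ d) hD (j + 1 + t') (j + 1) (by omega)).trans
    (mul_le_mul_of_nonneg_right (one_add_pow_le (2 ^ d) hD (j + 1 + t')) (by positivity))
  rw [pow_two_rpow, ← Real.rpow_add (by norm_num)] at hA hB
  rw [Nat.cast_mul]
  refine (mul_le_mul hA hB (by positivity) (by positivity)).trans ?_
  rw [← Real.rpow_add (by norm_num)]
  apply Real.rpow_le_rpow_of_exponent_le (by norm_num)
  have e1 : 2 * ((2 * t' : ℕ) : ℝ) / 2 ^ d = 4 * τ := by rw [hτ]; push_cast; ring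
  have e2 : 2 * ((j + 1 + t' : ℕ) : ℝ) / 2 ^ d ≤ 6 * τ := by
    rw [hτ, mul_div_assoc', div_le_div_iff_of_pos_right hD0]
    have : j + 1 + t' ≤ 3 * t' := by omega
    have h3 : ((j + 1 + t' : ℕ) : ℝ) ≤ 3 * t' := by exact_mod_cast this
    linarith
  have e3 : (d : ℝ) * j ≤ d * (2 * τ) := by gcongr
  push_cast at e1 e2 ⊢
  rw [e1]
  linarith

lemma numeric_c (d Δ : ℕ) (hΔ : 1 ≤ Δ) :
    (((4 * Δ * (64 * 2 ^ d) ^ Δ) ^ (d + 4) : ℕ) : ℝ) ≤ (2 : ℝ) ^ ((Δ : ℝ) * (d + 8) * (d + 4)) := by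
  have h1 : (4 * Δ * (64 * 2 ^ d) ^ Δ) ^ (d + 4) ≤ 2 ^ (Δ * (d + 8) * (d + 4)) := by
    rw [pow_mul]
    apply Nat.pow_le_pow_left
    have h2 : 4 * Δ ≤ 2 ^ (2 * Δ) := by
      have h3 : Δ < 2 ^ Δ := Nat.lt_two_pow_self
      have h5 : 2 ≤ 2 ^ Δ := by
        calc 2 = 2 ^ 1 := by norm_num
          _ ≤ 2 ^ Δ := Nat.pow_le_pow_right (by norm_num) hΔ
      obtain ⟨c, rfl⟩ : ∃ c, Δ = c + 1 := ⟨Δ - 1, by omega⟩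
      have h6 : c < 2 ^ c := Nat.lt_two_pow_self
      have h7 : 2 ^ (2 * (c + 1)) = 2 ^ (c + 1) * 2 ^ (c + 1) := by rw [← pow_add]; ring_nf
      rw [h7]
      have h8 : 2 ^ (c + 1) = 2 * 2 ^ c := by rw [pow_succ]; ring
      rw [h8]
      nlinarith
    calc 4 * Δ * (64 * 2 ^ d) ^ Δ ≤ 2 ^ (2 * Δ) * (64 * 2 ^ d) ^ Δ := by gcongr
      _ = 2 ^ (2 * Δ) * (2 ^ (6 + d)) ^ Δ := by rw [pow_add 2 6 d]; norm_num
      _ = _ := by rw [← pow_mul, ← pow_add]; ring_nf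
  have h2 : (((4 * Δ * (64 * 2 ^ d) ^ Δ) ^ (d + 4) : ℕ) : ℝ)
      ≤ ((2 ^ (Δ * (d + 8) * (d + 4)) : ℕ) : ℝ) := by exact_mod_cast h1
  refine h2.trans (le_of_eq ?_)
  rw [Nat.cast_pow, ← Real.rpow_natCast]
  push_cast
  rfl

lemma two_pow_bounds (i : ℕ) : (11 + 2 * i) * (9 + 2 * i) ≤ 100 * 2 ^ i ∧
    66 + 16 * i ≤ 66 * 2 ^ i ∧ 15 + 4 * i ≤ 16 * 2 ^ i := by
  induction i with
  | zero => norm_num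
  | succ i ih =>
    obtain ⟨h1, h2, h3⟩ := ih
    rw [pow_succ]
    have : i < 2 ^ i := Nat.lt_two_pow_self
    refine ⟨?_, by omega, by omega⟩
    nlinarith

lemma numeric_step (M m i t t' d Δ j : ℕ) (hm : m ≤ M ^ 2) (hM : 16 * 4 ^ i < M)
    (ht : t = 32 * 4 ^ i * M) (ht' : t' = 32 * 4 ^ (i + 1) * M) (hd : d = 14 + 4 * i)
    (hΔ : Δ = 2 * m / t) (hΔ1 : 1 ≤ Δ) (hj : j = 16 * t' / (8 * 2 ^ d)) :
    (((4 * Δ * (64 * 2 ^ d) ^ Δ) ^ (d + 4) *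
      ((∑ i ∈ Finset.range (j + 1), (2 * t').choose i) * (j + 1 + t').choose (j + 1)) : ℕ) : ℝ)
      ≤ (2 : ℝ) ^ (27 * (M / 2 ^ i : ℝ) - 1) := by
  have hM0 : 0 < M := by omega
  have ht'1 : 1 ≤ t' := by
    rw [ht']; exact Nat.mul_pos (Nat.mul_pos (by norm_num) (Nat.pow_pos (by norm_num))) hM0
  have hA := numeric_c d Δ hΔ1
  have hB := numeric_bc d t' j ht'1 (by omega) hj
  rw [Nat.cast_mul]
  refine (mul_le_mul hA hB (by positivity) (by positivity)).trans ?_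
  rw [← Real.rpow_add (by norm_num)]
  apply Real.rpow_le_rpow_of_exponent_le (by norm_num)
  set p : ℝ := 2 ^ i with hp
  have hp0 : 0 < p := by positivity
  have h4 : (4 : ℝ) ^ i = p * p := by rw [hp, ← mul_pow]; norm_num
  have hMr : (0 : ℝ) < M := by exact_mod_cast hM0
  set x : ℝ := M / p with hx
  have hMx : (M : ℝ) = x * p := by rw [hx]; field_simp
  have hx0 : 0 < x := by positivity
  have hxp : 16 * p ≤ x := by
    have : (16 * 4 ^ i : ℝ) < M := by exact_mod_cast hM
    rw [h4, hMx] at this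
    nlinarith
  obtain ⟨b1, b2, b3⟩ := two_pow_bounds i
  have b1' : ((11 + 2 * i) * (9 + 2 * i) : ℝ) ≤ 100 * p := by rw [hp]; exact_mod_cast b1
  have b2' : (66 + 16 * i : ℝ) ≤ 66 * p := by rw [hp]; exact_mod_cast b2
  have b3' : (15 + 4 * i : ℝ) ≤ 16 * p := by rw [hp]; exact_mod_cast b3
  have hΔr : (Δ : ℝ) * (16 * p) ≤ x := by
    have h1 : Δ * t ≤ 2 * m := by rw [hΔ]; exact Nat.div_mul_le_self _ _
    have h2 : Δ * t ≤ 2 * M ^ 2 := by omega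
    rw [ht] at h2
    have h3 : (Δ : ℝ) * (32 * 4 ^ i * M) ≤ 2 * M ^ 2 := by exact_mod_cast h2
    rw [h4, hMx] at h3
    have h5 : (2 * x * p ^ 2) * ((Δ : ℝ) * (16 * p)) ≤ (2 * x * p ^ 2) * x := by nlinarith
    exact le_of_mul_le_mul_left h5 (by positivity)
  have hτ : (t' / 2 ^ d : ℝ) = x / (128 * p) := by
    have e1 : (t' : ℝ) = 128 * (p * p) * (x * p) := by
      rw [ht']; push_cast; rw [pow_succ, h4, hMx]; ring
    have e2 : (2 : ℝ) ^ d = 16384 * (p * p * p * p) := by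
      rw [hd, pow_add, pow_mul, hp, ← mul_pow, ← mul_pow, ← mul_pow]; norm_num
    rw [e1, e2]
    field_simp
    norm_num
  rw [hτ]
  have hdr : (d : ℝ) = 14 + 4 * i := by rw [hd]; push_cast; ring
  rw [hdr]
  have c1 : (Δ : ℝ) * (14 + 4 * i + 8) * (14 + 4 * i + 4) ≤ 25 * x := by
    calc (Δ : ℝ) * (14 + 4 * i + 8) * (14 + 4 * i + 4)
        = Δ * 4 * ((11 + 2 * i) * (9 + 2 * i)) := by ring
      _ ≤ Δ * 4 * (100 * p) := by gcongr
      _ = 25 * (Δ * (16 * p)) := by ring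
      _ ≤ _ := by gcongr
  have c2 : (10 + 4 * (14 + 4 * i) : ℝ) * (x / (128 * p)) ≤ 66 / 128 * x := by
    calc (10 + 4 * (14 + 4 * i) : ℝ) * (x / (128 * p)) = (66 + 16 * i) * (x / (128 * p)) := by ring
      _ ≤ (66 * p) * (x / (128 * p)) := by gcongr
      _ = _ := by field_simp
  linarith

/-- The iteration. -/
lemma iterate_aux {α V : Type*} [Fintype α] (G : SimpleGraph α) (m M : ℕ) (hm1 : 1 ≤ m)
    (hmM : m ≤ M ^ 2) (hsum : ∑ v : α, dg G v Finset.univ = 2 * m)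
    (hn : Fintype.card α ≤ 2 * m) (I : ℕ) (hI : 2 * m ≤ 32 * 4 ^ I * M) :
    ∀ k i : ℕ, i + k = I → ∀ H : SimpleGraph V, ¬ IsCopyIn G H → ¬ IsCopyIn G Hᶜ →
      ∀ X Y : Finset V, MPair H X Y → 32 * 4 ^ i * M ≤ X.card →
        8 * (m : ℝ) * (2 : ℝ) ^ (54 * (M / 2 ^ i : ℝ)) ≤ Y.card → False := by
  classical
  have hbase : ∀ i : ℕ, 2 * m ≤ 32 * 4 ^ i * M → ∀ H : SimpleGraph V, ¬ IsCopyIn G H →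
      ∀ X Y : Finset V, MPair H X Y → 32 * 4 ^ i * M ≤ X.card → Y.Nonempty → False := by
    intro i hi H hno X Y hP hX hYne
    apply hno
    apply copy_of_mpair G H X Y hP ∅
    · simp only [Finset.notMem_empty, not_false_eq_true, Finset.filter_true, Finset.card_univ]
      omega
    · obtain ⟨y, hy⟩ := hYne
      exact ⟨fun _ => y, by simp, by simp, by simp⟩
  have hm0 : (1 : ℝ) ≤ m := by exact_mod_cast hm1
  have hYne : ∀ (Y : Finset V) (e : ℝ), 8 * (m : ℝ) * (2 : ℝ) ^ e ≤ Y.card → Y.Nonempty := by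
    intro Y e h
    rw [← Finset.card_pos]
    have : (0 : ℝ) < Y.card := lt_of_lt_of_le (by positivity) h
    exact_mod_cast this
  intro k
  induction k with
  | zero =>
    intro i hi H hno _ X Y hP hX hY
    rw [add_zero] at hi
    subst hi
    exact hbase i hI H hno X Y hP hX (hYne _ _ hY)
  | succ k ih =>
    intro i hi H hno hno' X Y hP hX hY
    by_cases hbig : 2 * m ≤ 32 * 4 ^ i * M
    · exact hbase i hbig H hno X Y hP hX (hYne _ _ hY)
    push Not at hbig
    have hM : 16 * 4 ^ i < M := by
      by_contra hcon
      push Not at hcon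
      nlinarith
    obtain ⟨t, ht⟩ : ∃ t, t = 32 * 4 ^ i * M := ⟨_, rfl⟩
    obtain ⟨t', ht'⟩ : ∃ t', t' = 32 * 4 ^ (i + 1) * M := ⟨_, rfl⟩
    obtain ⟨d, hd⟩ : ∃ d, d = 14 + 4 * i := ⟨_, rfl⟩
    obtain ⟨Δ, hΔ⟩ : ∃ Δ, Δ = 2 * m / t := ⟨_, rfl⟩
    obtain ⟨j, hj⟩ : ∃ j, j = 16 * t' / (8 * 2 ^ d) := ⟨_, rfl⟩
    have ht1 : 1 ≤ t := by
      rw [ht]; exact Nat.mul_pos (Nat.mul_pos (by norm_num) (Nat.pow_pos (by norm_num))) (by omega)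
    have htt' : t' = 4 * t := by rw [ht', ht, pow_succ]; ring
    have hΔ1 : 1 ≤ Δ := by rw [hΔ]; exact Nat.div_pos (by omega) ht1
    have hnum := numeric_step M m i t t' d Δ j hmM hM ht ht' hd hΔ hΔ1 hj
    set x : ℝ := M / 2 ^ i with hx
    have hx' : 54 * (M / 2 ^ (i + 1) : ℝ) = 27 * x := by rw [hx, pow_succ]; field_simp; ring
    have hx0 : 0 ≤ x := by positivity
    set R : ℝ := 8 * (m : ℝ) * (2 : ℝ) ^ (27 * x) with hR
    have hpow1 : (1 : ℝ) ≤ (2 : ℝ) ^ (27 * x) :=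
      Real.one_le_rpow (by norm_num) (by positivity)
    have hR8 : 8 * (m : ℝ) ≤ R := by rw [hR]; nlinarith
    obtain ⟨y', hy'⟩ : ∃ y', y' = ⌈R⌉₊ := ⟨_, rfl⟩
    have hy1 : R ≤ y' := by rw [hy']; exact Nat.le_ceil R
    have hy2 : (y' : ℝ) ≤ 2 * R := by
      have := Nat.ceil_lt_add_one (show 0 ≤ R by linarith)
      rw [hy']; linarith
    have hy8 : 8 * m ≤ y' := by
      have : (8 * m : ℝ) ≤ y' := hR8.trans hy1
      exact_mod_cast this
    have hYc : (4 * Δ * (64 * 2 ^ d) ^ Δ) ^ (d + 4) *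
        ((∑ i ∈ Finset.range (j + 1), (2 * t').choose i) *
        ((j + 1 + t').choose (j + 1) * y')) ≤ Y.card := by
      rw [← mul_assoc (∑ i ∈ Finset.range (j + 1), (2 * t').choose i), ← mul_assoc]
      rw [← Nat.cast_le (α := ℝ), Nat.cast_mul]
      refine le_trans ?_ hY
      refine (mul_le_mul hnum hy2 (by positivity) (by positivity)).trans (le_of_eq ?_)
      have e1 : (2 : ℝ) ^ (54 * x) = 2 ^ (27 * x - 1) * 2 ^ (1 : ℝ) * 2 ^ (27 * x) := by
        rw [← Real.rpow_add (by norm_num), ← Real.rpow_add (by norm_num)]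
        congr 1
        ring
      rw [e1, Real.rpow_one, hR]
      ring
    obtain ⟨X', Y', hX', hY', hP'⟩ := step G H X Y hP m t t' y' d Δ j hsum hno ht1 (by omega)
      (by omega) hΔ (by omega) (by omega) (by omega) (by omega) hj hYc
    have hY'' : 8 * (m : ℝ) * (2 : ℝ) ^ (54 * (M / 2 ^ (i + 1) : ℝ)) ≤ Y'.card := by
      rw [hx']
      exact hy1.trans (by exact_mod_cast hY')
    rcases hP' with hP' | hP'
    · exact ih (i + 1) (by omega) H hno hno' X' Y' hP' (by omega) hY''
    · exact ih (i + 1) (by omega) Hᶜ hno' (by rwa [compl_compl]) X' Y' hP' (by omega) hY''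

lemma final_numeric (m M : ℕ) (hm1 : 1 ≤ m) (hM : M = ⌈Real.sqrt m⌉₊) :
    (2 : ℝ) ^ (64 * (M : ℝ)) * (2 * (8 * (m : ℝ) * (2 : ℝ) ^ (54 * (M : ℝ)))) ≤
      (2 : ℝ) ^ (250 * Real.sqrt m) ∧ m ≤ M ^ 2 := by
  have hm0 : (1 : ℝ) ≤ m := by exact_mod_cast hm1
  have hs1 : 1 ≤ Real.sqrt m := by rw [Real.one_le_sqrt]; exact hm0
  have h1 : Real.sqrt m ≤ M := by rw [hM]; exact Nat.le_ceil _
  have h2 : (M : ℝ) < Real.sqrt m + 1 := by rw [hM]; exact Nat.ceil_lt_add_one (by linarith)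
  have h3 : (m : ℝ) ≤ (M : ℝ) ^ 2 := by
    rw [← Real.sq_sqrt (show (0 : ℝ) ≤ m by linarith)]
    gcongr
  have h4 : (M : ℝ) ≤ (2 : ℝ) ^ (M : ℝ) := by
    rw [Real.rpow_natCast]
    exact_mod_cast (Nat.lt_two_pow_self (n := M)).le
  refine ⟨?_, by exact_mod_cast h3⟩
  have h5 : (m : ℝ) ≤ (2 : ℝ) ^ (2 * (M : ℝ)) := by
    refine h3.trans ?_
    rw [two_mul, Real.rpow_add (by norm_num), sq]
    gcongr
  calc (2 : ℝ) ^ (64 * (M : ℝ)) * (2 * (8 * (m : ℝ) * (2 : ℝ) ^ (54 * (M : ℝ))))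
      ≤ (2 : ℝ) ^ (64 * (M : ℝ)) * (2 * (8 * ((2 : ℝ) ^ (2 * (M : ℝ))) *
        (2 : ℝ) ^ (54 * (M : ℝ)))) := by gcongr
    _ = (2 : ℝ) ^ (4 : ℝ) * (2 : ℝ) ^ (64 * (M : ℝ)) * (2 : ℝ) ^ (2 * (M : ℝ)) *
        (2 : ℝ) ^ (54 * (M : ℝ)) := by norm_num; ring
    _ = (2 : ℝ) ^ (4 + 64 * (M : ℝ) + 2 * (M : ℝ) + 54 * (M : ℝ)) := by
        rw [← Real.rpow_add (by norm_num), ← Real.rpow_add (by norm_num),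
          ← Real.rpow_add (by norm_num)]
    _ ≤ _ := by
        apply Real.rpow_le_rpow_of_exponent_le (by norm_num)
        linarith

lemma ramseyProp_floor {α : Type*} [Fintype α] (G : SimpleGraph α) (m : ℕ) (hm1 : 1 ≤ m)
    (hsum : ∑ v : α, dg G v Finset.univ = 2 * m)
    (hn : Fintype.card α ≤ 2 * m) :
    RamseyProp G G ⌊(2 : ℝ) ^ (250 * Real.sqrt m)⌋₊ := by
  classical
  intro blue
  by_contra hcon
  rw [not_or] at hcon
  obtain ⟨hb, hr⟩ := hcon
  obtain ⟨M, hM⟩ : ∃ M, M = ⌈Real.sqrt m⌉₊ := ⟨_, rfl⟩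
  obtain ⟨hnum, hmM⟩ := final_numeric m M hm1 hM
  have hm0 : (1 : ℝ) ≤ m := by exact_mod_cast hm1
  have hM1 : 1 ≤ M := by
    by_contra h
    have : M = 0 := by omega
    subst this
    omega
  set R : ℝ := 8 * (m : ℝ) * (2 : ℝ) ^ (54 * (M : ℝ)) with hR
  have hR1 : 1 ≤ R := by
    have : (1 : ℝ) ≤ (2 : ℝ) ^ (54 * (M : ℝ)) := Real.one_le_rpow (by norm_num) (by positivity)
    rw [hR]; nlinarith
  obtain ⟨y, hy⟩ : ∃ y, y = ⌈R⌉₊ := ⟨_, rfl⟩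
  have hy1 : R ≤ y := by rw [hy]; exact Nat.le_ceil R
  have hy2 : (y : ℝ) ≤ 2 * R := by
    have := Nat.ceil_lt_add_one (show 0 ≤ R by linarith)
    rw [hy]; linarith
  have hypos : 1 ≤ y := by
    have : (1 : ℝ) ≤ y := hR1.trans hy1
    exact_mod_cast this
  have hI : 2 * m ≤ 32 * 4 ^ (2 * m) * M := by
    have h1 : 2 * m < 4 ^ (2 * m) := Nat.lt_pow_self (by norm_num)
    nlinarith
  have hiter := iterate_aux (V := Fin ⌊(2 : ℝ) ^ (250 * Real.sqrt m)⌋₊) G m M hm1 hmM hsum hn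
    (2 * m) hI (2 * m) 0 (by omega)
  have hcard : (32 * M + 32 * M).choose (32 * M) * y ≤
      (Finset.univ : Finset (Fin ⌊(2 : ℝ) ^ (250 * Real.sqrt m)⌋₊)).card := by
    rw [Finset.card_univ, Fintype.card_fin]
    apply Nat.le_floor
    refine le_trans ?_ hnum
    rw [Nat.cast_mul]
    refine mul_le_mul ?_ hy2 (by positivity) (by positivity)
    have h1 : (32 * M + 32 * M).choose (32 * M) ≤ 2 ^ (64 * M) := by
      refine (Nat.choose_le_two_pow _ _).trans (le_of_eq ?_)
      congr 1
      ring
    have h2 : (2 : ℝ) ^ (64 * (M : ℝ)) = ((2 ^ (64 * M) : ℕ) : ℝ) := by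
      rw [Nat.cast_pow, ← Real.rpow_natCast]
      push_cast
      rfl
    rw [h2]
    exact_mod_cast h1
  have hYR : ∀ c : ℕ, y ≤ c → 8 * (m : ℝ) * (2 : ℝ) ^ (54 * (M / 2 ^ 0 : ℝ)) ≤ c := by
    intro c hc
    rw [pow_zero, div_one]
    exact hy1.trans (by exact_mod_cast hc)
  rcases mpair_exists blue y hypos (32 * M) (32 * M) Finset.univ hcard with
    ⟨X, Y, -, -, hXc, hYc, hP⟩ | ⟨X, Y, -, -, hXc, hYc, hP⟩
  · exact hiter blue hb hr X Y hP (by omega) (hYR _ hYc)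
  · exact hiter blueᶜ hr (by rwa [compl_compl]) X Y hP (by omega) (hYR _ hYc)

/-- Sudakov's theorem: the Erdős conjecture on graph Ramsey numbers. -/
theorem erdos_conjecture_diagonal {α : Type*} [Fintype α]
    (G : SimpleGraph α)
    (hiso : ∀ v : α, (G.neighborSet v).Nonempty)
    (m : ℕ) (hm : m = G.edgeSet.ncard) :
    (ramsey G G : ℝ) ≤ 2 ^ (250 * Real.sqrt m) := by
  classical
  have hdg : ∀ v, dg G v Finset.univ = G.degree v := by
    intro v
    rw [← SimpleGraph.card_neighborFinset_eq_degree, SimpleGraph.neighborFinset_eq_filter]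
    unfold dg
    congr
  have hsum : ∑ v : α, dg G v Finset.univ = 2 * m := by
    rw [Finset.sum_congr rfl (fun v _ => hdg v), SimpleGraph.sum_degrees_eq_twice_card_edges, hm,
      Set.ncard_eq_toFinset_card']
    rfl
  have hn : Fintype.card α ≤ 2 * m := by
    rw [← hsum, ← Finset.card_univ, Finset.card_eq_sum_ones]
    apply Finset.sum_le_sum
    intro v _
    rw [hdg v]
    obtain ⟨w, hw⟩ := hiso v
    exact (G.degree_pos_iff_exists_adj v).2 ⟨w, hw⟩
  rcases Nat.eq_zero_or_pos m with h0 | h0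
  · have hα : IsEmpty α := by
      rw [← Fintype.card_eq_zero_iff]; omega
    have h1 : ramsey G G ≤ 1 := by
      apply Nat.sInf_le
      refine ⟨one_pos, fun blue => Or.inl ⟨⟨fun a => isEmptyElim a, fun a => isEmptyElim a⟩, ?_⟩⟩
      intro a
      exact isEmptyElim a
    have h2 : (ramsey G G : ℝ) ≤ 1 := by exact_mod_cast h1
    rw [h0]
    simpa using h2
  · have hge : (1 : ℝ) ≤ (2 : ℝ) ^ (250 * Real.sqrt m) :=
      Real.one_le_rpow (by norm_num) (by positivity)
    have h1 : ramsey G G ≤ ⌊(2 : ℝ) ^ (250 * Real.sqrt m)⌋₊ :=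
      Nat.sInf_le ⟨Nat.floor_pos.2 hge, ramseyProp_floor G m h0 hsum hn⟩
    calc (ramsey G G : ℝ) ≤ (⌊(2 : ℝ) ^ (250 * Real.sqrt m)⌋₊ : ℝ) := by exact_mod_cast h1
      _ ≤ _ := Nat.floor_le (by linarith)
end

section
/- Suppose that for $i = 1, 2$, $G_i$ is a graph of order $n_i$, and let $n = \max\{n_1, n_2\}$. If for $i = 1, 2$ there exists a subset $U_i \subseteq V(G_i)$ with $|U_i| \leq 27 n^{1/3}$ such that $\Delta(G_i - U_i) \leq 54\, n^{1/3} / \log^3 n$, then $R(G_1, G_2) \leq 2^{250\, n^{1/3}}$. -/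
open Classical in
/-- Erdős–Szekeres type lemma. -/
theorem es_lemma {V : Type*} (Γ : SimpleGraph V) (M : ℕ) (hM : 1 ≤ M) :
    ∀ (s a b : ℕ), a + b = s → ∀ S : Finset V, 2 ^ s * M ≤ S.card →
    (∃ A B : Finset V, A ⊆ S ∧ B ⊆ S ∧ A.card = a ∧ M ≤ B.card ∧
      (∀ x ∈ A, ∀ y ∈ A, x ≠ y → Γ.Adj x y) ∧ (∀ x ∈ A, ∀ y ∈ B, Γ.Adj x y)) ∨
    (∃ A B : Finset V, A ⊆ S ∧ B ⊆ S ∧ A.card = b ∧ M ≤ B.card ∧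
      (∀ x ∈ A, ∀ y ∈ A, x ≠ y → Γᶜ.Adj x y) ∧ (∀ x ∈ A, ∀ y ∈ B, Γᶜ.Adj x y)) := by
  intro s
  induction s with
  | zero =>
    intro a b hab S hS
    left
    obtain rfl : a = 0 := by omega
    exact ⟨∅, S, by simp, by simp, by simp, by simpa using hS, by simp, by simp⟩
  | succ s ih =>
    intro a b hab S hS
    rcases Nat.eq_zero_or_pos a with rfl | ha
    · left
      exact ⟨∅, S, by simp, by simp, by simp,
        le_trans (Nat.le_mul_of_pos_left _ (by positivity)) hS, by simp, by simp⟩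
    rcases Nat.eq_zero_or_pos b with rfl | hb
    · right
      exact ⟨∅, S, by simp, by simp, by simp,
        le_trans (Nat.le_mul_of_pos_left _ (by positivity)) hS, by simp, by simp⟩
    have hpos : 0 < 2 ^ s * M := by positivity
    have hS2 : 2 * (2 ^ s * M) ≤ S.card := by rw [pow_succ] at hS; nlinarith
    obtain ⟨v, hv⟩ : S.Nonempty := by
      rw [← Finset.card_pos]; omega
    have hsplit := Finset.card_filter_add_card_filter_not (s := S.erase v) (fun y => Γ.Adj v y)
    rw [Finset.card_erase_of_mem hv] at hsplit
    by_cases hblue : 2 ^ s * M ≤ ((S.erase v).filter (fun y => Γ.Adj v y)).card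
    · rcases ih (a - 1) b (by omega) _ hblue with ⟨A, B, hA, hB, hAc, hBc, hAA, hAB⟩ | ⟨A, B, hA, hB, h⟩
      · left
        have hvA : v ∉ A := fun h => by simpa using hA h
        refine ⟨insert v A, B, ?_, ?_, ?_, hBc, ?_, ?_⟩
        · intro x hx
          rcases Finset.mem_insert.1 hx with rfl | hx
          · exact hv
          · have := hA hx; simp at this; exact this.1.2
        · intro x hx
          have := hB hx; simp at this; exact this.1.2
        · rw [Finset.card_insert_of_notMem hvA]; omega
        · intro x hx y hy hxy
          rcases Finset.mem_insert.1 hx with rfl | hx'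
          · rcases Finset.mem_insert.1 hy with rfl | hy
            · exact absurd rfl hxy
            · exact (Finset.mem_filter.1 (hA hy)).2
          · rcases Finset.mem_insert.1 hy with rfl | hy
            · exact ((Finset.mem_filter.1 (hA hx')).2).symm
            · exact hAA x hx' y hy hxy
        · intro x hx y hy
          rcases Finset.mem_insert.1 hx with rfl | hx
          · exact (Finset.mem_filter.1 (hB hy)).2
          · exact hAB x hx y hy
      · right
        refine ⟨A, B, fun x hx => ?_, fun x hx => ?_, h⟩
        · have := hA hx; simp at this; exact this.1.2
        · have := hB hx; simp at this; exact this.1.2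
    · have hred : 2 ^ s * M ≤ ((S.erase v).filter (fun y => ¬ Γ.Adj v y)).card := by omega
      have key : ∀ y ∈ (S.erase v).filter (fun y => ¬ Γ.Adj v y), Γᶜ.Adj v y := by
        intro y hy
        simp at hy
        rw [SimpleGraph.compl_adj]
        exact ⟨fun h => hy.1.1 h.symm, hy.2⟩
      rcases ih a (b - 1) (by omega) _ hred with ⟨A, B, hA, hB, h⟩ | ⟨A, B, hA, hB, hAc, hBc, hAA, hAB⟩
      · left
        refine ⟨A, B, fun x hx => ?_, fun x hx => ?_, h⟩
        · have := hA hx; simp at this; exact this.1.2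
        · have := hB hx; simp at this; exact this.1.2
      · right
        have hvA : v ∉ A := fun h => by simpa using hA h
        refine ⟨insert v A, B, ?_, ?_, ?_, hBc, ?_, ?_⟩
        · intro x hx
          rcases Finset.mem_insert.1 hx with rfl | hx
          · exact hv
          · have := hA hx; simp at this; exact this.1.2
        · intro x hx
          have := hB hx; simp at this; exact this.1.2
        · rw [Finset.card_insert_of_notMem hvA]; omega
        · intro x hx y hy hxy
          rcases Finset.mem_insert.1 hx with rfl | hx'
          · rcases Finset.mem_insert.1 hy with rfl | hy
            · exact absurd rfl hxy
            · exact key _ (hA hy)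
          · rcases Finset.mem_insert.1 hy with rfl | hy
            · exact (key _ (hA hx')).symm
            · exact hAA x hx' y hy hxy
        · intro x hx y hy
          rcases Finset.mem_insert.1 hx with rfl | hx
          · exact key _ (hB hy)
          · exact hAB x hx y hy

open Classical in
/-- Greedy embedding of a degenerate graph into the complement of a sparse graph. -/
theorem greedy_embed_s4 {α V : Type*} [Fintype α] (G : SimpleGraph α) (Γ : SimpleGraph V) (d r : ℕ)
    (hdeg : ∀ S : Finset α, S.Nonempty → ∃ v ∈ S, (S.filter (fun u => G.Adj v u)).card ≤ d)
    (T : Finset V) (hT : ∀ x ∈ T, (T.filter (fun y => Γ.Adj x y)).card ≤ r)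
    (hbig : d * r + Fintype.card α ≤ T.card) : IsCopyIn G Γᶜ := by
  have main : ∀ (s : ℕ) (S : Finset α), S.card = s → ∃ f : α → V,
      (∀ u ∈ S, f u ∈ T) ∧ (∀ u ∈ S, ∀ w ∈ S, f u = f w → u = w) ∧
      (∀ u ∈ S, ∀ w ∈ S, G.Adj u w → Γᶜ.Adj (f u) (f w)) := by
    intro s
    induction s with
    | zero =>
      intro S hS
      rw [Finset.card_eq_zero] at hS
      subst hS
      by_cases hα : Nonempty α
      · have : 0 < Fintype.card α := Fintype.card_pos
        obtain ⟨x, hx⟩ : T.Nonempty := by rw [← Finset.card_pos]; omega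
        exact ⟨fun _ => x, by simp, by simp, by simp⟩
      · rw [not_nonempty_iff] at hα
        exact ⟨fun a => hα.elim a, by simp, by simp, by simp⟩
    | succ s ih =>
      intro S hS
      obtain ⟨v, hv, hvd⟩ := hdeg S (by rw [← Finset.card_pos]; omega)
      obtain ⟨f, hfT, hfi, hfa⟩ := ih (S.erase v) (by rw [Finset.card_erase_of_mem hv]; omega)
      set P := (S.erase v).filter (fun u => G.Adj v u) with hP
      have hPc : P.card ≤ d := le_trans (Finset.card_le_card
        (Finset.filter_subset_filter _ (Finset.erase_subset _ _))) hvd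
      set Bad := P.biUnion (fun u => T.filter (fun y => Γ.Adj (f u) y)) with hBad
      have hBadc : Bad.card ≤ d * r := by
        refine le_trans (Finset.card_biUnion_le_card_mul P _ r ?_) (Nat.mul_le_mul_right _ hPc)
        intro u hu
        exact hT _ (hfT u (Finset.mem_filter.1 hu).1)
      have himg : ((S.erase v).image f).card < Fintype.card α := by
        refine lt_of_le_of_lt Finset.card_image_le ?_
        rw [Finset.card_erase_of_mem hv]
        have := Finset.card_le_univ S
        omega
      obtain ⟨x, hxT, hx⟩ : ∃ x ∈ T, x ∉ Bad ∪ (S.erase v).image f := by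
        apply Finset.exists_mem_notMem_of_card_lt_card
        have := Finset.card_union_le Bad ((S.erase v).image f)
        omega
      rw [Finset.mem_union, not_or] at hx
      have hxne : ∀ u ∈ S, u ≠ v → f u ≠ x := by
        intro u hu huv h
        exact hx.2 (Finset.mem_image.2 ⟨u, Finset.mem_erase.2 ⟨huv, hu⟩, h⟩)
      have hxadj : ∀ u ∈ S, u ≠ v → G.Adj v u → Γᶜ.Adj (f u) x := by
        intro u hu huv h
        rw [SimpleGraph.compl_adj]
        refine ⟨hxne u hu huv, fun h' => hx.1 ?_⟩
        exact Finset.mem_biUnion.2 ⟨u, Finset.mem_filter.2 ⟨Finset.mem_erase.2 ⟨huv, hu⟩, h⟩,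
          Finset.mem_filter.2 ⟨hxT, h'⟩⟩
      refine ⟨Function.update f v x, ?_, ?_, ?_⟩
      · intro u hu
        by_cases h : u = v
        · subst h; simpa using hxT
        · rw [Function.update_of_ne h]; exact hfT u (Finset.mem_erase.2 ⟨h, hu⟩)
      · intro u hu w hw huw
        by_cases h : u = v <;> by_cases h' : w = v
        · rw [h, h']
        · subst h
          rw [Function.update_self, Function.update_of_ne h'] at huw
          exact absurd huw.symm (hxne w hw h')
        · subst h'
          rw [Function.update_self, Function.update_of_ne h] at huw
          exact absurd huw (hxne u hu h)
        · rw [Function.update_of_ne h, Function.update_of_ne h'] at huw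
          exact hfi u (Finset.mem_erase.2 ⟨h, hu⟩) w (Finset.mem_erase.2 ⟨h', hw⟩) huw
      · intro u hu w hw huw
        by_cases h : u = v <;> by_cases h' : w = v
        · rw [h, h'] at huw; exact absurd huw (G.loopless.irrefl v)
        · subst h
          rw [Function.update_self, Function.update_of_ne h']
          exact (hxadj w hw h' huw).symm
        · subst h'
          rw [Function.update_self, Function.update_of_ne h]
          exact hxadj u hu h huw.symm
        · rw [Function.update_of_ne h, Function.update_of_ne h']
          exact hfa u (Finset.mem_erase.2 ⟨h, hu⟩) w (Finset.mem_erase.2 ⟨h', hw⟩) huw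
  obtain ⟨f, -, hi, ha⟩ := main _ Finset.univ rfl
  exact ⟨⟨f, fun a b h => hi a (Finset.mem_univ _) b (Finset.mem_univ _) h⟩,
    fun a b h => ha a (Finset.mem_univ _) b (Finset.mem_univ _) h⟩

open Classical in
/-- Embedding a bounded degree graph into a bi-dense graph. -/
theorem dense_embed {α V : Type*} [Fintype α] (H : SimpleGraph α) (Γ : SimpleGraph V)
    (k Δ m n : ℕ) (hdeg : ∀ v, (Finset.univ.filter (fun u => H.Adj v u)).card ≤ Δ)
    (hn : Fintype.card α ≤ n) (S : Finset V) (hne : S.Nonempty)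
    (hS : 2 ^ (k * Δ) * ((Δ + 1) * m + n) ≤ S.card)
    (hd : ∀ X Y : Finset V, X ⊆ S → Y ⊆ S → m ≤ X.card → m ≤ Y.card →
      ∃ x ∈ X, Y.card ≤ 2 ^ k * (Y.filter (fun y => Γ.Adj x y)).card) :
    ∃ f : α → V, Function.Injective f ∧ (∀ a, f a ∈ S) ∧ ∀ a b, H.Adj a b → Γ.Adj (f a) (f b) := by
  have main : ∀ D : Finset α, ∃ (f : α → V) (C : α → Finset V),
      (∀ u ∈ D, f u ∈ S) ∧ (∀ u ∈ D, ∀ w ∈ D, f u = f w → u = w) ∧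
      (∀ u ∈ D, ∀ w ∈ D, H.Adj u w → Γ.Adj (f u) (f w)) ∧
      (∀ u, C u ⊆ S) ∧
      (∀ u, u ∉ D → S.card ≤ 2 ^ (k * (D.filter (fun w => H.Adj u w)).card) * (C u).card) ∧
      (∀ u, u ∉ D → ∀ w ∈ D, H.Adj w u → ∀ x ∈ C u, Γ.Adj (f w) x) := by
    intro D
    induction D using Finset.induction_on with
    | empty =>
      obtain ⟨x, hx⟩ := hne
      exact ⟨fun _ => x, fun _ => S, by simp, by simp, by simp, by simp, by simp, by simp⟩
    | insert v D hvD ih =>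
      obtain ⟨f, C, hfS, hfi, hfa, hCS, hCc, hCa⟩ := ih
      have hCbig : ∀ u, u ∉ D → (Δ + 1) * m + n ≤ (C u).card := by
        intro u hu
        have h1 : (D.filter (fun w => H.Adj u w)).card ≤ Δ :=
          le_trans (Finset.card_le_card (Finset.filter_subset_filter _ (Finset.subset_univ _))) (hdeg u)
        have h2 : S.card ≤ 2 ^ (k * Δ) * (C u).card :=
          le_trans (hCc u hu) (Nat.mul_le_mul_right _
            (Nat.pow_le_pow_right (by norm_num) (Nat.mul_le_mul_left _ h1)))
        exact Nat.le_of_mul_le_mul_left (le_trans hS h2) (by positivity)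
      set P := (Finset.univ.filter (fun u => H.Adj v u)).filter (fun u => u ∉ D) with hP
      have hPc : P.card ≤ Δ := le_trans (Finset.card_filter_le _ _) (hdeg v)
      set X : α → Finset V := fun u => (C v).filter
        (fun x => ¬ (C u).card ≤ 2 ^ k * ((C u).filter (fun y => Γ.Adj x y)).card) with hX
      have hXc : ∀ u ∈ P, (X u).card ≤ m := by
        intro u hu
        by_contra hcon
        push Not at hcon
        have huD : u ∉ D := (Finset.mem_filter.1 hu).2
        obtain ⟨x, hx, hx2⟩ := hd (X u) (C u) (fun y hy => hCS v (Finset.mem_filter.1 hy).1)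
          (hCS u) hcon.le (by have := hCbig u huD; nlinarith)
        exact (Finset.mem_filter.1 hx).2 hx2
      have hbad : (P.biUnion X).card ≤ Δ * m :=
        le_trans (Finset.card_biUnion_le_card_mul P X m hXc) (Nat.mul_le_mul_right _ hPc)
      have himg : (D.image f).card < n := by
        refine lt_of_le_of_lt Finset.card_image_le (lt_of_lt_of_le ?_ hn)
        exact Finset.card_lt_univ_of_notMem hvD
      obtain ⟨x, hxC, hx⟩ : ∃ x ∈ C v, x ∉ P.biUnion X ∪ D.image f := by
        apply Finset.exists_mem_notMem_of_card_lt_card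
        have := Finset.card_union_le (P.biUnion X) (D.image f)
        have := hCbig v hvD
        nlinarith
      rw [Finset.mem_union, not_or] at hx
      have hne' : ∀ u ∈ D, u ≠ v := fun u hu h => hvD (h ▸ hu)
      have hxne : ∀ u ∈ D, f u ≠ x := fun u hu h => hx.2 (Finset.mem_image.2 ⟨u, hu, h⟩)
      refine ⟨Function.update f v x,
        fun u => if H.Adj v u then (C u).filter (fun y => Γ.Adj x y) else C u, ?_, ?_, ?_, ?_, ?_, ?_⟩
      · intro u hu
        rcases Finset.mem_insert.1 hu with rfl | hu
        · simpa using hCS _ hxC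
        · rw [Function.update_of_ne (hne' u hu)]; exact hfS u hu
      · intro u hu w hw huw
        rcases Finset.mem_insert.1 hu with rfl | hu' <;> rcases Finset.mem_insert.1 hw with rfl | hw
        · rfl
        · rw [Function.update_self, Function.update_of_ne (hne' w hw)] at huw
          exact absurd huw.symm (hxne w hw)
        · rw [Function.update_self, Function.update_of_ne (hne' u hu')] at huw
          exact absurd huw (hxne u hu')
        · rw [Function.update_of_ne (hne' u hu'), Function.update_of_ne (hne' w hw)] at huw
          exact hfi u hu' w hw huw
      · intro u hu w hw huw
        rcases Finset.mem_insert.1 hu with rfl | hu' <;> rcases Finset.mem_insert.1 hw with rfl | hw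
        · exact absurd huw (H.loopless.irrefl _)
        · rw [Function.update_self, Function.update_of_ne (hne' w hw)]
          exact (hCa _ hvD w hw huw.symm x hxC).symm
        · rw [Function.update_self, Function.update_of_ne (hne' u hu')]
          exact hCa _ hvD u hu' huw x hxC
        · rw [Function.update_of_ne (hne' u hu'), Function.update_of_ne (hne' w hw)]
          exact hfa u hu' w hw huw
      · intro u
        dsimp only
        split_ifs
        · exact (Finset.filter_subset _ _).trans (hCS u)
        · exact hCS u
      · intro u hu
        rw [Finset.mem_insert, not_or] at hu
        dsimp only
        rw [Finset.filter_insert]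
        by_cases h : H.Adj v u
        · have hvf : v ∉ D.filter (fun w => H.Adj u w) := fun h => hvD (Finset.mem_filter.1 h).1
          rw [if_pos h, if_pos h.symm, Finset.card_insert_of_notMem hvf]
          have hgood : (C u).card ≤ 2 ^ k * ((C u).filter (fun y => Γ.Adj x y)).card := by
            by_contra hcon
            refine hx.1 (Finset.mem_biUnion.2 ⟨u, ?_, Finset.mem_filter.2 ⟨hxC, hcon⟩⟩)
            simp [hP, h, hu.2]
          calc S.card ≤ _ := hCc u hu.2
            _ ≤ _ := Nat.mul_le_mul_left _ hgood
            _ = _ := by rw [mul_add, pow_add, mul_one, mul_assoc]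
        · rw [if_neg h, if_neg (fun h' => h h'.symm)]
          exact hCc u hu.2
      · intro u hu w hw hwu y hy
        rw [Finset.mem_insert, not_or] at hu
        dsimp only at hy
        rcases Finset.mem_insert.1 hw with rfl | hw
        · rw [if_pos hwu] at hy
          rw [Function.update_self]
          exact (Finset.mem_filter.1 hy).2
        · rw [Function.update_of_ne (hne' w hw)]
          refine hCa u hu.2 w hw hwu y ?_
          split_ifs at hy
          · exact (Finset.mem_filter.1 hy).1
          · exact hy
  obtain ⟨f, C, hS, hi, ha, -⟩ := main Finset.univ
  exact ⟨f, fun a b h => hi a (Finset.mem_univ _) b (Finset.mem_univ _) h,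
    fun a => hS a (Finset.mem_univ _),
    fun a b h => ha a (Finset.mem_univ _) b (Finset.mem_univ _) h⟩

open Classical in
theorem sparse_tree {α V : Type*} [Fintype α] (H : SimpleGraph α) (Γ : SimpleGraph V)
    (k Δ n : ℕ) (hdeg : ∀ v, (Finset.univ.filter (fun u => H.Adj v u)).card ≤ Δ)
    (hn : Fintype.card α ≤ n) (hn1 : 1 ≤ n) (S0 : Finset V)
    (hno : ¬ ∃ f : α → V, Function.Injective f ∧ (∀ a, f a ∈ S0) ∧
      ∀ a b, H.Adj a b → Γ.Adj (f a) (f b)) :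
    ∀ h : ℕ, ∀ S ⊆ S0, n * (2 ^ (k * Δ) * (4 * Δ + 5)) ^ h ≤ S.card →
      ∃ T ⊆ S, T.card = 2 ^ h * n ∧
        2 ^ k * ∑ x ∈ T, (T.filter (fun y => Γ.Adj x y)).card
          ≤ n ^ 2 * (2 ^ k * 2 ^ h + 2 * 4 ^ h) := by
  intro h
  induction h with
  | zero =>
    intro S hS hc
    obtain ⟨T, hTS, hT⟩ := Finset.exists_subset_card_eq (show n ≤ S.card by simpa using hc)
    refine ⟨T, hTS, by simpa using hT, ?_⟩
    have : ∑ x ∈ T, (T.filter (fun y => Γ.Adj x y)).card ≤ n * n := by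
      rw [← hT, ← smul_eq_mul]
      exact Finset.sum_le_card_nsmul _ _ _ (fun x _ => Finset.card_filter_le _ _)
    calc _ ≤ 2 ^ k * (n * n) := Nat.mul_le_mul_left _ this
      _ ≤ _ := by nlinarith [sq_nonneg n]
  | succ h ih =>
    intro S hSS hc
    set K := 2 ^ (k * Δ) * (4 * Δ + 5) with hK
    set M := n * K ^ h with hM
    have hK2 : 2 ≤ K := by
      have : 1 ≤ 2 ^ (k * Δ) := Nat.one_le_two_pow
      nlinarith
    have hMn : 2 ^ h * n ≤ M := by
      rw [hM, mul_comm]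
      exact Nat.mul_le_mul_left _ (Nat.pow_le_pow_left hK2 h)
    have hMn1 : n ≤ M := le_trans (Nat.le_mul_of_pos_left _ (by positivity)) hMn
    have hKM : 2 ^ (k * Δ) * ((Δ + 1) * (4 * M) + n) ≤ S.card := by
      refine le_trans ?_ hc
      have : n * K ^ (h + 1) = 2 ^ (k * Δ) * ((4 * Δ + 5) * M) := by
        rw [pow_succ, hM, hK]; ring
      rw [this]
      apply Nat.mul_le_mul_left
      nlinarith
    have hSpos : 0 < S.card := by
      refine lt_of_lt_of_le ?_ hKM
      have : 0 < 2 ^ (k * Δ) := by positivity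
      positivity
    have hpair : ∃ X Y : Finset V, X ⊆ S ∧ Y ⊆ S ∧ 4 * M ≤ X.card ∧ 4 * M ≤ Y.card ∧
        ∀ x ∈ X, 2 ^ k * (Y.filter (fun y => Γ.Adj x y)).card < Y.card := by
      by_contra hcon
      push Not at hcon
      obtain ⟨f, hf, hfS, hfa⟩ := dense_embed H Γ k Δ (4 * M) n hdeg hn S (Finset.card_pos.1 hSpos) hKM hcon
      exact hno ⟨f, hf, fun a => hSS (hfS a), hfa⟩
    obtain ⟨X, Y, hXS, hYS, hXc, hYc, hXY⟩ := hpair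
    obtain ⟨A, hAX, hAc, hAe⟩ := ih X (hXS.trans hSS) (by omega)
    have hApos : 0 < A.card := by rw [hAc]; positivity
    set Bad := Y.filter (fun y => 2 * A.card < 2 ^ k * (A.filter (fun x => Γ.Adj y x)).card) with hBad
    have hdc : ∀ P Q : Finset V, ∑ y ∈ P, (Q.filter (fun x => Γ.Adj y x)).card =
        ∑ x ∈ Q, (P.filter (fun y => Γ.Adj x y)).card := by
      intro P Q
      simp only [Finset.card_filter]
      rw [Finset.sum_comm]
      simp only [Γ.adj_comm]
    have hBadc : 2 * Bad.card ≤ Y.card := by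
      have h1 : Bad.card * (2 * A.card) ≤ ∑ y ∈ Bad, 2 ^ k * (A.filter (fun x => Γ.Adj y x)).card := by
        rw [← smul_eq_mul]
        exact Finset.card_nsmul_le_sum _ _ _ (fun y hy => (Finset.mem_filter.1 hy).2.le)
      have h2 : ∑ y ∈ Bad, 2 ^ k * (A.filter (fun x => Γ.Adj y x)).card ≤
          ∑ y ∈ Y, 2 ^ k * (A.filter (fun x => Γ.Adj y x)).card :=
        Finset.sum_le_sum_of_subset (Finset.filter_subset _ _)
      have h3 : ∑ y ∈ Y, 2 ^ k * (A.filter (fun x => Γ.Adj y x)).card ≤ A.card * Y.card := by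
        rw [← Finset.mul_sum, hdc, Finset.mul_sum, ← smul_eq_mul (a := A.card)]
        exact Finset.sum_le_card_nsmul _ _ _ (fun x hx => (hXY x (hAX hx)).le)
      have h4 : A.card * (2 * Bad.card) ≤ A.card * Y.card := by
        calc _ = Bad.card * (2 * A.card) := by ring
          _ ≤ _ := h1.trans (h2.trans h3)
      exact Nat.le_of_mul_le_mul_left h4 hApos
    have hY' : M ≤ ((Y \ Bad) \ A).card := by
      have h1 := Finset.le_card_sdiff Bad Y
      have h2 := Finset.le_card_sdiff A (Y \ Bad)
      omega
    obtain ⟨B, hBY, hBc, hBe⟩ := ih ((Y \ Bad) \ A)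
      ((Finset.sdiff_subset.trans Finset.sdiff_subset).trans (hYS.trans hSS)) hY'
    have hdisj : Disjoint A B := by
      rw [Finset.disjoint_left]
      intro x hxA hxB
      exact (Finset.mem_sdiff.1 (hBY hxB)).2 hxA
    have hBS : B ⊆ S := hBY.trans ((Finset.sdiff_subset.trans Finset.sdiff_subset).trans hYS)
    refine ⟨A ∪ B, Finset.union_subset (hAX.trans hXS) hBS, ?_, ?_⟩
    · rw [Finset.card_union_of_disjoint hdisj, hAc, hBc, pow_succ]; ring
    · have hu : ∀ x, ((A ∪ B).filter (fun y => Γ.Adj x y)).card =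
          (A.filter (fun y => Γ.Adj x y)).card + (B.filter (fun y => Γ.Adj x y)).card := by
        intro x
        rw [Finset.filter_union, Finset.card_union_of_disjoint
          (Finset.disjoint_filter_filter hdisj)]
      rw [Finset.sum_union hdisj]
      simp only [hu, Finset.sum_add_distrib]
      rw [hdc A B]
      have hcross : 2 ^ k * ∑ x ∈ B, (A.filter (fun y => Γ.Adj x y)).card ≤ 2 * (2 ^ h * n) ^ 2 := by
        rw [Finset.mul_sum]
        have : ∑ x ∈ B, 2 ^ k * (A.filter (fun y => Γ.Adj x y)).card ≤ B.card * (2 * A.card) := by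
          rw [← smul_eq_mul]
          apply Finset.sum_le_card_nsmul
          intro x hx
          have h1 := (Finset.mem_sdiff.1 (Finset.mem_sdiff.1 (hBY hx)).1)
          by_contra hcon
          push Not at hcon
          exact h1.2 (Finset.mem_filter.2 ⟨h1.1, hcon⟩)
        rw [hAc, hBc] at this
        nlinarith
      have e4 : (4 : ℕ) ^ h = 2 ^ h * 2 ^ h := by rw [← mul_pow]; norm_num
      rw [pow_succ 4 h, pow_succ 2 h]
      rw [e4] at hAe hBe ⊢
      nlinarith

open Classical in
theorem core_lemma {α β V : Type*} [Fintype α] [Fintype β] (H : SimpleGraph α) (G : SimpleGraph β)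
    (Γ : SimpleGraph V) (h Δ n d : ℕ)
    (hdeg : ∀ v, (Finset.univ.filter (fun u => H.Adj v u)).card ≤ Δ)
    (hnα : Fintype.card α ≤ n) (hnβ : Fintype.card β ≤ n) (hn1 : 1 ≤ n)
    (hdeg2 : ∀ S : Finset β, S.Nonempty → ∃ v ∈ S, (S.filter (fun u => G.Adj v u)).card ≤ d)
    (hd : 12 * d + 2 ≤ 2 ^ h) (S : Finset V)
    (hS : n * (2 ^ (h * Δ) * (4 * Δ + 5)) ^ h ≤ S.card) :
    (∃ f : α → V, Function.Injective f ∧ (∀ a, f a ∈ S) ∧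
      ∀ a b, H.Adj a b → Γ.Adj (f a) (f b)) ∨ IsCopyIn G Γᶜ := by
  by_cases hno : ∃ f : α → V, Function.Injective f ∧ (∀ a, f a ∈ S) ∧
      ∀ a b, H.Adj a b → Γ.Adj (f a) (f b)
  · exact Or.inl hno
  right
  obtain ⟨T, hTS, hTc, hTe⟩ := sparse_tree H Γ h Δ n hdeg hnα hn1 S hno h S subset_rfl hS
  have e4 : (4 : ℕ) ^ h = 2 ^ h * 2 ^ h := by rw [← mul_pow]; norm_num
  have hpos : 0 < 2 ^ h := by positivity
  have hTe' : ∑ x ∈ T, (T.filter (fun y => Γ.Adj x y)).card ≤ 3 * n * T.card := by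
    rw [hTc]
    refine Nat.le_of_mul_le_mul_left (le_trans hTe ?_) hpos
    rw [e4]
    apply le_of_eq
    ring
  set Bad := T.filter (fun x => 6 * n < (T.filter (fun y => Γ.Adj x y)).card) with hBad
  have hBadc : 2 * Bad.card ≤ T.card := by
    have h1 : Bad.card * (6 * n) ≤ ∑ x ∈ Bad, (T.filter (fun y => Γ.Adj x y)).card := by
      rw [← smul_eq_mul]
      exact Finset.card_nsmul_le_sum _ _ _ (fun y hy => (Finset.mem_filter.1 hy).2.le)
    have h2 : ∑ x ∈ Bad, (T.filter (fun y => Γ.Adj x y)).card ≤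
        ∑ x ∈ T, (T.filter (fun y => Γ.Adj x y)).card :=
      Finset.sum_le_sum_of_subset (Finset.filter_subset _ _)
    have h4 : (3 * n) * (2 * Bad.card) ≤ (3 * n) * T.card := by
      calc _ = Bad.card * (6 * n) := by ring
        _ ≤ _ := h1.trans (h2.trans hTe')
    exact Nat.le_of_mul_le_mul_left h4 (by positivity)
  refine greedy_embed_s4 G Γ d (6 * n) hdeg2 (T \ Bad) ?_ ?_
  · intro x hx
    have h1 := Finset.mem_sdiff.1 hx
    refine le_trans (Finset.card_le_card (Finset.filter_subset_filter _ Finset.sdiff_subset)) ?_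
    by_contra hcon
    push Not at hcon
    exact h1.2 (Finset.mem_filter.2 ⟨h1.1, hcon⟩)
  · have h1 := Finset.le_card_sdiff Bad T
    have h2 : (12 * d + 2) * n ≤ T.card := by rw [hTc]; exact Nat.mul_le_mul_right _ hd
    have h3 : (12 * d + 2) * n = 2 * (d * (6 * n)) + 2 * n := by ring
    omega

open Classical in
theorem join_lemma {α V : Type*} [Fintype α] (G : SimpleGraph α) (Γ : SimpleGraph V) (U : Set α)
    (A B : Finset V) (hU : U.ncard ≤ A.card)
    (hA : ∀ x ∈ A, ∀ y ∈ A, x ≠ y → Γ.Adj x y) (hAB : ∀ x ∈ A, ∀ y ∈ B, Γ.Adj x y)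
    (f : ↥(Uᶜ) → V) (hf : Function.Injective f) (hfB : ∀ a, f a ∈ B)
    (hfa : ∀ a b, (G.induce Uᶜ).Adj a b → Γ.Adj (f a) (f b)) : IsCopyIn G Γ := by
  obtain ⟨g⟩ : Nonempty (U ↪ A) := by
    apply Function.Embedding.nonempty_of_card_le
    rw [Fintype.card_coe, ← Nat.card_eq_fintype_card]
    exact hU
  have hdis : ∀ (a : U) (b : ↥(Uᶜ)), (g a : V) ≠ f b := by
    intro a b h
    have := hAB _ (g a).2 _ (hfB b)
    rw [h] at this
    exact Γ.loopless.irrefl _ this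
  let φ : α → V := fun a => if h : a ∈ U then g ⟨a, h⟩ else f ⟨a, h⟩
  refine ⟨⟨φ, ?_⟩, ?_⟩
  · intro a b hab
    by_cases ha : a ∈ U <;> by_cases hb : b ∈ U <;> simp only [φ, ha, hb, dif_pos, dif_neg, not_false_eq_true] at hab
    · have := g.injective (Subtype.ext hab)
      simpa using this
    · exact absurd hab (hdis _ _)
    · exact absurd hab.symm (hdis _ _)
    · have := hf hab
      simpa using this
  · intro a b hab
    show Γ.Adj (φ a) (φ b)
    by_cases ha : a ∈ U <;> by_cases hb : b ∈ U <;> simp only [φ, ha, hb, dif_pos, dif_neg, not_false_eq_true]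
    · apply hA _ (g _).2 _ (g _).2
      intro h
      have := g.injective (Subtype.ext h)
      simp only [Subtype.mk.injEq] at this
      exact hab.ne this
    · exact hAB _ (g _).2 _ (hfB _)
    · exact (hAB _ (g _).2 _ (hfB _)).symm
    · exact hfa _ _ hab

open Classical in
theorem degen_lemma {α : Type*} [Fintype α] (G : SimpleGraph α) (U : Set α) (a Δ : ℕ)
    (hU : U.ncard ≤ a) (hdeg : ∀ v, ((G.induce Uᶜ).neighborSet v).ncard ≤ Δ)
    (S : Finset α) (hS : S.Nonempty) : ∃ v ∈ S, (S.filter (fun u => G.Adj v u)).card ≤ a + Δ := by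
  by_cases h : ∃ v ∈ S, v ∉ U
  · obtain ⟨v, hv, hvU⟩ := h
    refine ⟨v, hv, ?_⟩
    rw [← Set.ncard_coe_finset]
    have hsub : ((S.filter (fun u => G.Adj v u) : Finset α) : Set α) ⊆
        U ∪ Subtype.val '' ((G.induce Uᶜ).neighborSet ⟨v, hvU⟩) := by
      intro u hu
      simp at hu
      by_cases huU : u ∈ U
      · exact Or.inl huU
      · exact Or.inr ⟨⟨u, huU⟩, by simpa using hu.2, rfl⟩
    calc _ ≤ _ := Set.ncard_le_ncard hsub (Set.toFinite _)
      _ ≤ _ := Set.ncard_union_le _ _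
      _ ≤ a + Δ := add_le_add hU ((Set.ncard_image_le (Set.toFinite _)).trans (hdeg _))
  · push Not at h
    obtain ⟨v, hv⟩ := hS
    refine ⟨v, hv, ?_⟩
    rw [← Set.ncard_coe_finset]
    refine le_trans (Set.ncard_le_ncard (t := U) ?_ (Set.toFinite _)) (by omega)
    intro u hu
    simp at hu
    exact h u hu.1

open Classical in
theorem half_lemma {α β V : Type*} [Fintype α] [Fintype β] (G₁ : SimpleGraph α)
    (G₂ : SimpleGraph β) (Γ : SimpleGraph V) (U₁ : Set α) (U₂ : Set β) (a Δ n h : ℕ)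
    (hU₁ : U₁.ncard ≤ a) (hU₂ : U₂.ncard ≤ a)
    (hd₁ : ∀ v, ((G₁.induce U₁ᶜ).neighborSet v).ncard ≤ Δ)
    (hd₂ : ∀ v, ((G₂.induce U₂ᶜ).neighborSet v).ncard ≤ Δ)
    (hn₁ : Fintype.card α ≤ n) (hn₂ : Fintype.card β ≤ n) (hn : 1 ≤ n)
    (hh : 12 * (a + Δ) + 2 ≤ 2 ^ h) (A B : Finset V) (hAc : A.card = a)
    (hBc : n * (2 ^ (h * Δ) * (4 * Δ + 5)) ^ h ≤ B.card)
    (hA : ∀ x ∈ A, ∀ y ∈ A, x ≠ y → Γ.Adj x y) (hAB : ∀ x ∈ A, ∀ y ∈ B, Γ.Adj x y) :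
    IsCopyIn G₁ Γ ∨ IsCopyIn G₂ Γᶜ := by
  have h1 : ∀ v, (Finset.univ.filter (fun u => (G₁.induce U₁ᶜ).Adj v u)).card ≤ Δ := by
    intro v
    rw [← Set.ncard_coe_finset]
    refine le_trans (le_of_eq ?_) (hd₁ v)
    congr 1
    ext u
    simp
  have h2 : Fintype.card ↥(U₁ᶜ) ≤ n :=
    le_trans (Fintype.card_le_of_injective _ Subtype.val_injective) hn₁
  rcases core_lemma (G₁.induce U₁ᶜ) G₂ Γ h Δ n (a + Δ) h1 h2 hn₂ hn
    (fun S hS => degen_lemma G₂ U₂ a Δ hU₂ hd₂ S hS) hh B hBc with ⟨f, hf, hfB, hfa⟩ | h3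
  · left
    exact join_lemma G₁ Γ U₁ A B (by omega) hA hAB f hf hfB hfa
  · exact Or.inr h3

open Classical in
theorem ramsey_nat {α β : Type*} [Fintype α] [Fintype β] (G₁ : SimpleGraph α)
    (G₂ : SimpleGraph β) (U₁ : Set α) (U₂ : Set β) (a Δ n h : ℕ)
    (hU₁ : U₁.ncard ≤ a) (hU₂ : U₂.ncard ≤ a)
    (hd₁ : ∀ v, ((G₁.induce U₁ᶜ).neighborSet v).ncard ≤ Δ)
    (hd₂ : ∀ v, ((G₂.induce U₂ᶜ).neighborSet v).ncard ≤ Δ)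
    (hn₁ : Fintype.card α ≤ n) (hn₂ : Fintype.card β ≤ n) (hn : 1 ≤ n)
    (hh : 12 * (a + Δ) + 2 ≤ 2 ^ h) :
    ramsey G₁ G₂ ≤ 2 ^ (a + a) * (n * (2 ^ (h * Δ) * (4 * Δ + 5)) ^ h) := by
  have hM : 1 ≤ n * (2 ^ (h * Δ) * (4 * Δ + 5)) ^ h := Nat.succ_le_of_lt (by positivity)
  apply Nat.sInf_le
  refine ⟨by positivity, ?_⟩
  intro Γ
  rcases es_lemma Γ _ hM (a + a) a a rfl Finset.univ (by rw [Finset.card_univ, Fintype.card_fin]) with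
    ⟨A, B, -, -, hAc, hBc, hA, hAB⟩ | ⟨A, B, -, -, hAc, hBc, hA, hAB⟩
  · exact half_lemma G₁ G₂ Γ U₁ U₂ a Δ n h hU₁ hU₂ hd₁ hd₂ hn₁ hn₂ hn hh A B hAc hBc hA hAB
  · have := half_lemma G₂ G₁ Γᶜ U₂ U₁ a Δ n h hU₂ hU₁ hd₂ hd₁ hn₂ hn₁ hn hh A B hAc hBc hA hAB
    rw [compl_compl] at this
    exact this.symm

open Classical in
theorem ramsey_small {α β : Type*} [Fintype α] [Fintype β] (G₁ : SimpleGraph α)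
    (G₂ : SimpleGraph β) (n : ℕ) (hn₁ : Fintype.card α ≤ n) (hn₂ : Fintype.card β ≤ n) :
    ramsey G₁ G₂ ≤ 2 ^ (n + n) := by
  apply Nat.sInf_le
  refine ⟨by positivity, ?_⟩
  intro Γ
  rcases es_lemma Γ 1 le_rfl (n + n) n n rfl Finset.univ (by simp) with
    ⟨A, B, -, -, hAc, hBc, hA, hAB⟩ | ⟨A, B, -, -, hAc, hBc, hA, hAB⟩
  · left
    exact join_lemma G₁ Γ Set.univ A B (by rw [Set.ncard_univ, Nat.card_eq_fintype_card]; omega)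
      hA hAB (fun a => (a.2 trivial).elim) (fun a => (a.2 trivial).elim)
      (fun a => (a.2 trivial).elim) (fun a => (a.2 trivial).elim)
  · right
    exact join_lemma G₂ Γᶜ Set.univ A B (by rw [Set.ncard_univ, Nat.card_eq_fintype_card]; omega)
      hA hAB (fun a => (a.2 trivial).elim) (fun a => (a.2 trivial).elim)
      (fun a => (a.2 trivial).elim) (fun a => (a.2 trivial).elim)

theorem numeric_lemma (c l : ℝ) (hc : 11 ≤ c) (hl : c = 2 ^ l) (a Δ n h : ℕ) (hn : (n : ℝ) = c ^ 3)
    (ha : (a : ℝ) ≤ 27 * c) (hΔ : (Δ : ℝ) ≤ 2 * c / l ^ 3) (hh : (2 : ℝ) ^ h ≤ 680 * c) :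
    ((2 ^ (a + a) * (n * (2 ^ (h * Δ) * (4 * Δ + 5)) ^ h) : ℕ) : ℝ) ≤ 2 ^ (250 * c) := by
  have hc0 : 0 < c := by linarith
  have two : (1 : ℝ) < 2 := by norm_num
  have hl1 : 3.4 ≤ l := by
    rw [← Real.rpow_le_rpow_left_iff two, ← hl]
    refine le_trans ?_ hc
    refine le_of_pow_le_pow_left₀ (n := 5) (by norm_num) (by norm_num) ?_
    rw [← Real.rpow_natCast, ← Real.rpow_mul (by norm_num)]
    have : (3.4 : ℝ) * ((5 : ℕ) : ℝ) = ((17 : ℕ) : ℝ) := by norm_num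
    rw [this, Real.rpow_natCast]
    norm_num
  have hl0 : 0 < l := by linarith
  have hl2 : l ^ 2 ≤ 5 * c := by
    have h1 : c = Real.exp (Real.log 2 * l) := by
      rw [hl, Real.rpow_def_of_pos (by norm_num)]
    have h2 := Real.quadratic_le_exp_of_nonneg (x := Real.log 2 * l) (by positivity)
    rw [← h1] at h2
    have h3 := Real.log_two_gt_d9
    have h4 : 0.69 * l ≤ Real.log 2 * l := by nlinarith
    have h5 : (0.69 * l) ^ 2 ≤ (Real.log 2 * l) ^ 2 := pow_le_pow_left₀ (by positivity) h4 2
    nlinarith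
  have hhl : (h : ℝ) ≤ l + 10 := by
    rw [← Real.rpow_le_rpow_left_iff two, Real.rpow_natCast, Real.rpow_add (by norm_num), ← hl]
    have : (2 : ℝ) ^ (10 : ℝ) = 1024 := by
      rw [show (10 : ℝ) = ((10 : ℕ) : ℝ) by norm_num, Real.rpow_natCast]; norm_num
    rw [this]; linarith
  have hh4 : (h : ℝ) ≤ 4 * l := by linarith
  have hl3 : 39 ≤ l ^ 3 := by
    have : (3.4 : ℝ) ^ 3 ≤ l ^ 3 := pow_le_pow_left₀ (by norm_num) hl1 3
    norm_num at this ⊢; linarith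
  have hΔc : (Δ : ℝ) * l ^ 3 ≤ 2 * c := by rwa [le_div_iff₀ (by positivity)] at hΔ
  have hΔ1 : 39 * (Δ : ℝ) ≤ 2 * c := by
    have : (0 : ℝ) ≤ Δ := by positivity
    nlinarith
  have h45 : 4 * (Δ : ℝ) + 5 ≤ c := by linarith
  have hhΔ : (h : ℝ) * (h * Δ) ≤ 10 * c := by
    have h0 : (0 : ℝ) ≤ Δ := by positivity
    have h1 : (h : ℝ) * h ≤ (4 * l) * (4 * l) := by gcongr
    have h2 : (h : ℝ) * h * Δ ≤ 16 * l ^ 2 * Δ := by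
      have := mul_le_mul_of_nonneg_right h1 h0
      nlinarith
    have h3 : 3.4 * (l ^ 2 * Δ) ≤ Δ * l ^ 3 := by
      have : 0 ≤ l ^ 2 * Δ := by positivity
      nlinarith
    nlinarith
  have hhl2 : (h : ℝ) * l ≤ 20 * c := by nlinarith
  push_cast
  calc (2 : ℝ) ^ (a + a) * (n * (2 ^ (h * Δ) * (4 * Δ + 5)) ^ h)
      ≤ (2 : ℝ) ^ (a + a) * (c ^ 3 * (2 ^ (h * Δ) * c) ^ h) := by
        rw [hn]; gcongr
    _ = (2 : ℝ) ^ ((a : ℝ) + a + (3 * l + (h * (h * Δ) + h * l))) := by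
        have e1 : (2 : ℝ) ^ (a + a) = 2 ^ ((a : ℝ) + a) := by
          rw [← Real.rpow_natCast]; push_cast; rfl
        have e2 : c ^ 3 = (2 : ℝ) ^ (3 * l) := by
          rw [hl, ← Real.rpow_natCast, ← Real.rpow_mul (by norm_num)]; congr 1; push_cast; ring
        have e3 : ((2 : ℝ) ^ (h * Δ)) ^ h = 2 ^ ((h : ℝ) * (h * Δ)) := by
          rw [← pow_mul, ← Real.rpow_natCast]; congr 1; push_cast; ring
        have e4 : c ^ h = (2 : ℝ) ^ (h * l) := by
          rw [hl, ← Real.rpow_natCast, ← Real.rpow_mul (by norm_num)]; congr 1; ring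
        rw [mul_pow, e1, e2, e3, e4, ← Real.rpow_add (by norm_num), ← Real.rpow_add (by norm_num),
          ← Real.rpow_add (by norm_num)]
    _ ≤ 2 ^ (250 * c) := by
        apply Real.rpow_le_rpow_of_exponent_le (by norm_num)
        nlinarith

/-- Corollary: Ramsey bound in terms of the number of vertices for graphs that are
almost of bounded maximum degree. -/
theorem ramsey_le_two_pow_cbrt {α β : Type*} [Fintype α] [Fintype β]
    (G₁ : SimpleGraph α) (G₂ : SimpleGraph β)
    (n : ℕ) (hn : n = max (Fintype.card α) (Fintype.card β))
    (hU₁ : ∃ U₁ : Set α, (U₁.ncard : ℝ) ≤ 27 * (n : ℝ) ^ ((1 : ℝ) / 3) ∧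
      ∀ v, (((G₁.induce U₁ᶜ).neighborSet v).ncard : ℝ) ≤
        54 * (n : ℝ) ^ ((1 : ℝ) / 3) / (Real.logb 2 n) ^ 3)
    (hU₂ : ∃ U₂ : Set β, (U₂.ncard : ℝ) ≤ 27 * (n : ℝ) ^ ((1 : ℝ) / 3) ∧
      ∀ v, (((G₂.induce U₂ᶜ).neighborSet v).ncard : ℝ) ≤
        54 * (n : ℝ) ^ ((1 : ℝ) / 3) / (Real.logb 2 n) ^ 3) :
    (ramsey G₁ G₂ : ℝ) ≤ 2 ^ (250 * (n : ℝ) ^ ((1 : ℝ) / 3)) := by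
  set c : ℝ := (n : ℝ) ^ ((1 : ℝ) / 3) with hc
  have hc0 : 0 ≤ c := by positivity
  have hc3 : (n : ℝ) = c ^ 3 := by
    rw [hc, ← Real.rpow_natCast, ← Real.rpow_mul (by positivity)]; norm_num
  have hn₁ : Fintype.card α ≤ n := by omega
  have hn₂ : Fintype.card β ≤ n := by omega
  rcases le_total c 11 with hsmall | hbig
  · have h1 : (ramsey G₁ G₂ : ℝ) ≤ ((2 ^ (n + n) : ℕ) : ℝ) := by
      exact_mod_cast ramsey_small G₁ G₂ n hn₁ hn₂
    refine le_trans h1 ?_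
    push_cast
    rw [← Real.rpow_natCast]
    apply Real.rpow_le_rpow_of_exponent_le (by norm_num)
    push_cast
    rw [hc3]
    have : c ^ 2 ≤ 125 := by nlinarith
    nlinarith
  · obtain ⟨U₁, hU₁, hd₁⟩ := hU₁
    obtain ⟨U₂, hU₂, hd₂⟩ := hU₂
    have hcpos : 0 < c := by linarith
    set l := Real.logb 2 c with hl
    have hcl : c = 2 ^ l := (Real.rpow_logb (by norm_num) (by norm_num) hcpos).symm
    have hL : Real.logb 2 n = 3 * l := by
      rw [hc3, Real.logb_pow, hl]; norm_num
    have hΔe : 54 * c / (Real.logb 2 n) ^ 3 = 2 * c / l ^ 3 := by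
      rw [hL, mul_pow, show 54 * c = 3 ^ 3 * (2 * c) by ring, mul_div_mul_left _ _ (by norm_num)]
    rw [hΔe] at hd₁ hd₂
    have hl3 : 3 ≤ l := by
      rw [hl, Real.le_logb_iff_rpow_le (by norm_num) hcpos]
      norm_num; linarith
    have hl27 : 27 ≤ l ^ 3 := by
      have : (3 : ℝ) ^ 3 ≤ l ^ 3 := pow_le_pow_left₀ (by norm_num) hl3 3
      linarith
    have hΔ0 : 0 ≤ 2 * c / l ^ 3 := by positivity
    have hΔ1 : 2 * c / l ^ 3 ≤ 2 * c / 27 := by gcongr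
    have ha := Nat.floor_le (show 0 ≤ 27 * c by positivity)
    have hΔ := Nat.floor_le hΔ0
    set a := ⌊27 * c⌋₊
    set Δ := ⌊2 * c / l ^ 3⌋₊
    obtain ⟨h, hh1, hh2⟩ := exists_nat_pow_near (show (1 : ℝ) ≤ 340 * c by linarith)
      (show (1 : ℝ) < 2 by norm_num)
    have hnpos : 1 ≤ n := by
      rcases Nat.eq_zero_or_pos n with h0 | h0
      · rw [h0] at hc3
        have : 0 < c ^ 3 := by positivity
        simp at hc3
        linarith
      · exact h0
    have key := ramsey_nat G₁ G₂ U₁ U₂ a Δ n (h + 1) (Nat.le_floor hU₁) (Nat.le_floor hU₂)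
      (fun v => Nat.le_floor (hd₁ v)) (fun v => Nat.le_floor (hd₂ v)) hn₁ hn₂ hnpos (by
        have : ((12 * (a + Δ) + 2 : ℕ) : ℝ) ≤ ((2 ^ (h + 1) : ℕ) : ℝ) := by
          push_cast
          linarith
        exact_mod_cast this)
    refine le_trans (Nat.cast_le.2 key) ?_
    refine numeric_lemma c l hbig hcl a Δ n (h + 1) hc3 ha hΔ ?_
    rw [pow_succ]; linarith
end
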